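/- arXiv:2507.07228 — 10 statements merged into one kernel-verified Lean document; each statement's English description precedes it below -/
import Mathlib

section
/- Let (Ω, F, P) be a complete probability space, X a real-valued random variable, and g : ℝ → ℝ a nondecreasing function. Suppose that with probability one, X does not lie in the closure of any flat spot of g. Then for every integrable real-valued random variable A, the conditional expectations satisfy E[A | σ(X)] = E[A | σ(g ∘ X)] P-almost surely. -/
open MeasureTheory Set

/-- `x` lies in the closure of a flat spot of `g`, i.e. in the closure of a (maximal) open
interval on which the nondecreasing function `g` is constant. -/
def InFlatSpotClosure (g : ℝ → ℝ) (x : ℝ) : Prop :=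
  ∃ a b : ℝ, a < b ∧ (∀ y ∈ Set.Ioo a b, ∀ z ∈ Set.Ioo a b, g y = g z) ∧ x ∈ Set.Icc a b

/-- The generalized inverse `y ↦ sup {x | g x ≤ y}` of `g`, with values in the extended reals. -/
noncomputable def genInverse (g : ℝ → ℝ) (y : ℝ) : EReal :=
  ⨆ (x : ℝ) (_ : g x ≤ y), (x : EReal)

theorem monotone_genInverse (g : ℝ → ℝ) : Monotone (genInverse g) := fun _ _ h =>
  iSup_mono fun _ => iSup_mono' fun hx => ⟨hx.trans h, le_rfl⟩

theorem genInverse_apply_of_not_inFlatSpotClosure {g : ℝ → ℝ} (hg : Monotone g) {x : ℝ}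
    (hx : ¬ InFlatSpotClosure g x) : genInverse g (g x) = x := by
  refine le_antisymm (iSup₂_le fun z hz => ?_) (le_iSup₂_of_le x le_rfl le_rfl)
  rw [EReal.coe_le_coe_iff]
  by_contra! hxz
  have hconst : ∀ y ∈ Ioo x z, g y = g x := fun y hy =>
    le_antisymm ((hg hy.2.le).trans hz) (hg hy.1.le)
  exact hx ⟨x, z, hxz, fun y hy w hw => (hconst y hy).trans (hconst w hw).symm,
    left_mem_Icc.2 hxz.le⟩

/-- If `X` is almost surely a measurable function of `Y`, and `Y` generates a coarser σ-algebra
than `X`, then conditioning on `X` and on `Y` agree. -/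
theorem condExp_comap_ae_eq_of_comp_ae_eq {Ω α β : Type*} [m : MeasurableSpace Ω]
    [mα : MeasurableSpace α] [mβ : MeasurableSpace β] {P : Measure Ω} [IsFiniteMeasure P]
    {X : Ω → α} (hX : Measurable X) {Y : Ω → β} (hYX : mβ.comap Y ≤ mα.comap X)
    {h : β → α} (hh : Measurable h) (hXY : h ∘ Y =ᵐ[P] X) (A : Ω → ℝ) :
    P[A | mα.comap X] =ᵐ[P] P[A | mβ.comap Y] := by
  obtain ⟨φ, hφ, hφX⟩ :=
    (stronglyMeasurable_condExp (μ := P) (f := A) (m := mα.comap X)).exists_eq_measurable_comp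
  have hY : AEStronglyMeasurable[mβ.comap Y] (P[A | mα.comap X]) P := by
    refine ⟨φ ∘ h ∘ Y, ((hφ.measurable.comp hh).comp (comap_measurable Y)).stronglyMeasurable, ?_⟩
    rw [hφX]
    filter_upwards [hXY] with ω hω
    exact congrArg φ hω.symm
  exact (condExp_of_aestronglyMeasurable' (hYX.trans hX.comap_le) hY integrable_condExp).symm.trans
    (condExp_condExp_of_le hYX hX.comap_le)

/-- If, almost surely, the random variable `X` does not lie in the closure of any flat spot of
the nondecreasing function `g`, then conditioning on `σ(X)` and on `σ(g ∘ X)` give the same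
conditional expectation for every integrable random variable `A`. -/
theorem condexp_comap_eq_condexp_comap_comp_of_no_flat_spot
    {Ω : Type*} [m : MeasurableSpace Ω] (P : Measure Ω) [IsProbabilityMeasure P]
    [P.IsComplete] (X : Ω → ℝ) (hX : Measurable X)
    (g : ℝ → ℝ) (hg : Monotone g)
    (hflat : ∀ᵐ ω ∂P, ¬ InFlatSpotClosure g (X ω))
    (A : Ω → ℝ) (hA : Integrable A P) :
    P[A | MeasurableSpace.comap X Real.measurableSpace]
      =ᵐ[P] P[A | MeasurableSpace.comap (fun ω => g (X ω)) Real.measurableSpace] := by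
  refine condExp_comap_ae_eq_of_comp_ae_eq (Y := fun ω => g (X ω)) hX
    (hg.measurable.comp (comap_measurable X)).comap_le
    (h := fun y => (genInverse g y).toReal) (monotone_genInverse g).measurable.ereal_toReal ?_ A
  filter_upwards [hflat] with ω hω
  simp [genInverse_apply_of_not_inFlatSpotClosure hg hω]
end

section
/- Let (Ω, F, P) be a complete probability space, X a real-valued random variable, and g : ℝ → ℝ a nondecreasing function. Let N denote the σ-algebra generated by the P-null sets of F. If with probability one X does not lie in the closure of any flat spot of g, then σ(X) ∨ N = σ(g ∘ X) ∨ N, where ∨ denotes the join (generated σ-algebra) of two sub-σ-algebras. -/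
open MeasureTheory Set

/-- If a monotone `g` does not strictly increase from `c` to `x > c`, then `x` lies in the closure
of a flat spot of `g`. -/
theorem inFlatSpotClosure_of_lt_of_le {g : ℝ → ℝ} (hg : Monotone g) {c x : ℝ} (hcx : c < x)
    (h : g x ≤ g c) : InFlatSpotClosure g x := by
  have hconst : ∀ y ∈ Ioo c x, g y = g c := fun y hy =>
    le_antisymm ((hg hy.2.le).trans h) (hg hy.1.le)
  exact ⟨c, x, hcx, fun y hy z hz => (hconst y hy).trans (hconst z hz).symm,
    right_mem_Icc.mpr hcx.le⟩

/-- If, almost surely, `X` does not lie in the closure of any flat spot of the nondecreasing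
function `g`, then `σ(X) ∨ N = σ(g ∘ X) ∨ N`, where `N` is the σ-algebra generated by the
`P`-null sets. -/
theorem comap_sup_null_eq_comap_comp_sup_null_of_no_flat_spot
    {Ω : Type*} [m : MeasurableSpace Ω] (P : Measure Ω) [IsProbabilityMeasure P]
    [P.IsComplete] (X : Ω → ℝ) (hX : Measurable X)
    (g : ℝ → ℝ) (hg : Monotone g)
    (hflat : ∀ᵐ ω ∂P, ¬ InFlatSpotClosure g (X ω)) :
    MeasurableSpace.comap X Real.measurableSpace
        ⊔ MeasurableSpace.generateFrom {s : Set Ω | MeasurableSet s ∧ P s = 0}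
      = MeasurableSpace.comap (fun ω => g (X ω)) Real.measurableSpace
        ⊔ MeasurableSpace.generateFrom {s : Set Ω | MeasurableSet s ∧ P s = 0} := by
  refine le_antisymm (sup_le ?_ le_sup_right) (sup_le ?_ le_sup_right)
  · rw [← measurable_iff_comap_le]
    refine measurable_of_Iic fun c => ?_
    set T : Set Ω := {ω | g (X ω) ≤ g c}
    have hsub : X ⁻¹' Iic c ⊆ T := fun ω hω => hg hω
    have hnull : P (T \ X ⁻¹' Iic c) = 0 := by
      refine measure_mono_null (fun ω hω => ?_) hflat
      simpa using inFlatSpotClosure_of_lt_of_le hg (not_le.mp hω.2) hω.1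
    rw [← sdiff_sdiff_eq_self hsub]
    refine MeasurableSet.diff ?_ ?_
    · exact (le_sup_left : _ ≤ _ ⊔ MeasurableSpace.generateFrom _) _
        ⟨Iic (g c), measurableSet_Iic, rfl⟩
    · exact (le_sup_right : _ ≤ MeasurableSpace.comap _ _ ⊔ _) _
        (MeasurableSpace.measurableSet_generateFrom ⟨measurableSet_of_null hnull, hnull⟩)
  · refine le_trans ?_ le_sup_left
    exact measurable_iff_comap_le.mp (hg.measurable.comp (comap_measurable X))
end

section
/- Let (E_U, 𝔘, ρ) be a probability space and let κ₀, κ₁ be Markov kernels from E_U to ℝ such that κ₀(u) and κ₁(u) are atomless Borel probability measures for every u. Let γ : ℝ → ℝ be nondecreasing and Borel measurable with the pushforward of κ₀(u) under γ equal to κ₁(u) for every u. Define the mixture measures μ̄_t(B) := ∫ κ_t(u)(B) dρ(u) for t = 0, 1. Then: (a) the pushforward of μ̄₀ under γ equals μ̄₁, and F_{μ̄₁}(γ(y)) = F_{μ̄₀}(y) for every y ∈ ℝ; (b) γ(y) = Q_{μ̄₁}(F_{μ̄₀}(y)) for μ̄₀-almost every y. -/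
open MeasureTheory ProbabilityTheory Set

/-- The cumulative distribution function of a Borel measure on `ℝ`: `F_μ(x) = μ((-∞, x])`. -/
noncomputable def distFn (μ : Measure ℝ) (x : ℝ) : ℝ := (μ (Set.Iic x)).toReal

/-- The quantile function of a Borel measure on `ℝ`: `Q_μ(p) = inf {x | F_μ(x) ≥ p}`. -/
noncomputable def quantileFn (μ : Measure ℝ) (p : ℝ) : ℝ := sInf {x : ℝ | p ≤ distFn μ x}

/-- The set of right endpoints `w` for which `(a, w]` is null is itself null. -/
lemma measure_setOf_measure_Ioc_eq_zero (μ : Measure ℝ) (a : ℝ) :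
    μ {w | a < w ∧ μ (Ioc a w) = 0} = 0 := by
  refine measure_null_of_locally_null _ fun w hw => ?_
  by_cases h : ∃ w', w < w' ∧ μ (Ioc a w') = 0
  · obtain ⟨w', hww', hw'⟩ := h
    exact ⟨Ioc a w', mem_nhdsWithin_of_mem_nhds (Ioc_mem_nhds hw.1 hww'), hw'⟩
  · push Not at h
    refine ⟨Ioc a w, ?_, hw.2⟩
    filter_upwards [self_mem_nhdsWithin] with v hv
    exact ⟨hv.1, not_lt.1 fun hwv => h v hwv hv.2⟩

lemma measure_Ioc_eq_zero_of_distFn_le (μ : Measure ℝ) [IsFiniteMeasure μ] {x w : ℝ}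
    (hxw : x ≤ w) (h : distFn μ w ≤ distFn μ x) : μ (Ioc x w) = 0 := by
  have h' : μ (Iic w) ≤ μ (Iic x) :=
    (ENNReal.toReal_le_toReal (measure_ne_top _ _) (measure_ne_top _ _)).1 h
  rw [← Iic_sdiff_Iic, measure_sdiff (Iic_subset_Iic.2 hxw) measurableSet_Iic.nullMeasurableSet
    (measure_ne_top _ _)]
  exact tsub_eq_zero_of_le h'

/-- The quantile function of a finite measure is almost everywhere a left inverse of its
distribution function. -/
lemma ae_quantileFn_distFn (μ : Measure ℝ) [IsFiniteMeasure μ] :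
    ∀ᵐ w ∂μ, quantileFn μ (distFn μ w) = w := by
  have hq : ∀ᵐ w ∂μ, ∀ q : ℚ, ¬((q : ℝ) < w ∧ μ (Ioc (q : ℝ) w) = 0) :=
    ae_all_iff.2 fun q => measure_eq_zero_iff_ae_notMem.1
      (measure_setOf_measure_Ioc_eq_zero μ (q : ℝ))
  filter_upwards [hq] with w hw
  refine IsLeast.csInf_eq ⟨le_refl (distFn μ w), fun x hx => not_lt.1 fun hxw => ?_⟩
  obtain ⟨q, hxq, hqw⟩ := exists_rat_btwn hxw
  exact hw q ⟨hqw, measure_mono_null (Ioc_subset_Ioc_left hxq.le)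
    (measure_Ioc_eq_zero_of_distFn_le μ hxw.le hx)⟩

/-- A monotone map intertwines the distribution functions of a measure and its pushforward,
provided that the pushforward is atomless. -/
lemma distFn_map_apply_of_monotone (μ : Measure ℝ) {γ : ℝ → ℝ} (hγ : Monotone γ)
    (hatom : ∀ x, μ.map γ {x} = 0) (y : ℝ) : distFn (μ.map γ) (γ y) = distFn μ y := by
  have hfiber : μ (γ ⁻¹' {γ y}) = 0 := by
    rw [← Measure.map_apply hγ.measurable (measurableSet_singleton _)]
    exact hatom _
  unfold distFn
  rw [Measure.map_apply hγ.measurable measurableSet_Iic]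
  congr 1
  refine le_antisymm ?_ (measure_mono fun z hz => hγ hz)
  calc μ (γ ⁻¹' Iic (γ y)) ≤ μ (Iic y ∪ γ ⁻¹' {γ y}) := measure_mono fun z hz =>
        (le_total z y).imp id fun hyz => le_antisymm hz (hγ hyz)
    _ ≤ μ (Iic y) + μ (γ ⁻¹' {γ y}) := measure_union_le _ _
    _ = μ (Iic y) := by rw [hfiber, add_zero]

/-- If a nondecreasing Borel map `γ` simultaneously transports the atomless conditional laws
`κ₀(u)` to `κ₁(u)` for every value `u` of the latent variable, then (a) `γ` transports the
mixture `μ̄₀ = ∫ κ₀(u) dρ(u)` to the mixture `μ̄₁ = ∫ κ₁(u) dρ(u)` and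
`F_{μ̄₁}(γ(y)) = F_{μ̄₀}(y)` for every `y`, and (b) `γ` agrees `μ̄₀`-almost everywhere with the
quantile-quantile transform `y ↦ Q_{μ̄₁}(F_{μ̄₀}(y))` of the mixtures. -/
theorem mixture_transport_of_kernel_transport
    {E_U : Type*} [MeasurableSpace E_U] (ρ : Measure E_U) [IsProbabilityMeasure ρ]
    (κ₀ κ₁ : Kernel E_U ℝ) [IsMarkovKernel κ₀] [IsMarkovKernel κ₁]
    (h₀a : ∀ u, ∀ x : ℝ, κ₀ u {x} = 0) (h₁a : ∀ u, ∀ x : ℝ, κ₁ u {x} = 0)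
    (γ : ℝ → ℝ) (hγmono : Monotone γ) (hγmeas : Measurable γ)
    (hγ : ∀ u, Measure.map γ (κ₀ u) = κ₁ u) :
    (Measure.map γ (ρ.bind (fun u => κ₀ u)) = ρ.bind (fun u => κ₁ u)
      ∧ ∀ y : ℝ, distFn (ρ.bind (fun u => κ₁ u)) (γ y) = distFn (ρ.bind (fun u => κ₀ u)) y)
    ∧ (∀ᵐ y ∂(ρ.bind (fun u => κ₀ u)),
        γ y = quantileFn (ρ.bind (fun u => κ₁ u)) (distFn (ρ.bind (fun u => κ₀ u)) y)) := by
  have hmap : Measure.map γ (ρ.bind (fun u => κ₀ u)) = ρ.bind (fun u => κ₁ u) := by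
    ext s hs
    rw [Measure.map_apply hγmeas hs,
      Measure.bind_apply (hγmeas hs) κ₀.measurable.aemeasurable,
      Measure.bind_apply hs κ₁.measurable.aemeasurable]
    refine lintegral_congr fun u => ?_
    rw [← hγ u, Measure.map_apply hγmeas hs]
  have hatom : ∀ x, Measure.map γ (ρ.bind (fun u => κ₀ u)) {x} = 0 := fun x => by
    rw [hmap, Measure.bind_apply (measurableSet_singleton x) κ₁.measurable.aemeasurable]
    simp [h₁a]
  have hF : ∀ y, distFn (ρ.bind (fun u => κ₁ u)) (γ y) = distFn (ρ.bind (fun u => κ₀ u)) y :=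
    fun y => by rw [← hmap, distFn_map_apply_of_monotone _ hγmono hatom]
  have : IsFiniteMeasure (ρ.bind (fun u => κ₁ u)) :=
    inferInstanceAs (IsFiniteMeasure (ρ.bind κ₁))
  refine ⟨⟨hmap, hF⟩, ?_⟩
  have hae : ∀ᵐ w ∂(Measure.map γ (ρ.bind (fun u => κ₀ u))),
      quantileFn (ρ.bind (fun u => κ₁ u)) (distFn (ρ.bind (fun u => κ₁ u)) w) = w :=
    hmap ▸ ae_quantileFn_distFn (ρ.bind (fun u => κ₁ u))
  filter_upwards [ae_of_ae_map hγmeas.aemeasurable hae] with y hy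
  rw [← hF y, hy]
end

section
/- Let μ be a Borel probability measure on ℝ whose CDF F_μ is continuous and strictly increasing, and let h₀, h₁ : ℝ → ℝ be strictly increasing continuous bijections. Then for every y ∈ ℝ, Q_{(h₁)∗μ}(F_{(h₀)∗μ}(y)) = h₁(h₀⁻¹(y)). In particular, the quantile–quantile transform of the pushforward measures (h₀)∗μ and (h₁)∗μ does not depend on μ. -/
open MeasureTheory Set

/-- The CDF of the pushforward of `μ` under a strictly increasing `h`, at a point of the range. -/
theorem distFn_map_apply (μ : Measure ℝ) {h : ℝ → ℝ} (hs : StrictMono h) (x : ℝ) :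
    distFn (Measure.map h μ) (h x) = distFn μ x := by
  have hpre : h ⁻¹' Iic (h x) = Iic x := by
    ext t
    simp [hs.le_iff_le]
  rw [distFn, distFn, Measure.map_apply hs.monotone.measurable measurableSet_Iic, hpre]

/-- A strictly increasing CDF is inverted by the quantile function. -/
theorem quantileFn_distFn {μ : Measure ℝ} (hs : StrictMono (distFn μ)) (x : ℝ) :
    quantileFn μ (distFn μ x) = x := by
  have hset : {t : ℝ | distFn μ x ≤ distFn μ t} = Ici x := by
    ext t
    simp [hs.le_iff_le]
  rw [quantileFn, hset, csInf_Ici]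

/-- Strict monotonicity of the CDF is preserved by strictly increasing bijections. -/
theorem strictMono_distFn_map {μ : Measure ℝ} (hF : StrictMono (distFn μ)) {h : ℝ → ℝ}
    (hs : StrictMono h) (hsurj : Function.Surjective h) :
    StrictMono (distFn (Measure.map h μ)) := by
  intro a b hab
  obtain ⟨a, rfl⟩ := hsurj a
  obtain ⟨b, rfl⟩ := hsurj b
  rw [distFn_map_apply μ hs, distFn_map_apply μ hs]
  exact hF (hs.lt_iff_lt.mp hab)

/-- If `μ` has continuous strictly increasing CDF and `h₀, h₁` are strictly increasing
continuous bijections of `ℝ`, then the quantile-quantile transform of the pushforwards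
`(h₀)∗μ` and `(h₁)∗μ` is `y ↦ h₁(h₀⁻¹(y))`; in particular it does not depend on `μ`. -/
theorem quantile_quantile_of_pushforwards
    (μ : Measure ℝ) [IsProbabilityMeasure μ]
    (hFc : Continuous (distFn μ)) (hFs : StrictMono (distFn μ))
    (h₀ h₁ : ℝ → ℝ)
    (h₀s : StrictMono h₀) (h₀c : Continuous h₀) (h₀b : Function.Bijective h₀)
    (h₁s : StrictMono h₁) (h₁c : Continuous h₁) (h₁b : Function.Bijective h₁) :
    ∀ y : ℝ, quantileFn (Measure.map h₁ μ) (distFn (Measure.map h₀ μ) y)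
      = h₁ (Function.invFun h₀ y) := by
  intro y
  obtain ⟨x, rfl⟩ := h₀b.surjective y
  rw [Function.leftInverse_invFun h₀b.injective x, distFn_map_apply μ h₀s,
    ← distFn_map_apply μ h₁s,
    quantileFn_distFn (strictMono_distFn_map hFs h₁s h₁b.surjective)]
end

section
/- Let μ be a Borel probability measure on ℝ with continuous and strictly increasing CDF, let β₀, β₁ : ℝ → ℝ be strictly increasing continuous bijections, and let c₀, c₁ ∈ ℝ. For t = 0, 1, let μ_t be the pushforward of μ under the map x ↦ β_t(x + c_t). Then for every y ∈ ℝ, Q_{μ₁}(F_{μ₀}(y)) = β₁(β₀⁻¹(y) + c₁ − c₀). In particular, if c_t = k_t + m for reals k₀, k₁ and m, then Q_{μ₁}(F_{μ₀}(y)) = β₁(β₀⁻¹(y) + k₁ − k₀), which does not depend on m. -/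
open MeasureTheory Set

theorem distFn_map_comp_add_const {μ : Measure ℝ} {β : ℝ → ℝ} (hβ : StrictMono β) (c z : ℝ) :
    distFn (Measure.map (fun x => β (x + c)) μ) (β z) = distFn μ (z - c) := by
  have hmeas : Measurable fun x => β (x + c) :=
    hβ.monotone.measurable.comp (measurable_id.add_const c)
  have hpre : (fun x => β (x + c)) ⁻¹' Iic (β z) = Iic (z - c) := by
    ext x
    simp [hβ.le_iff_le, le_sub_iff_add_le]
  rw [distFn, Measure.map_apply hmeas measurableSet_Iic, hpre, distFn]

theorem quantileFn_distFn_of_strictMono {ν : Measure ℝ} (hν : StrictMono (distFn ν)) (x : ℝ) :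
    quantileFn ν (distFn ν x) = x := by
  have hset : {w : ℝ | distFn ν x ≤ distFn ν w} = Ici x := by
    ext w
    simp [hν.le_iff_le]
  rw [quantileFn, hset, csInf_Ici]

theorem strictMono_distFn_map_comp_add_const {μ : Measure ℝ} (hμ : StrictMono (distFn μ))
    {β : ℝ → ℝ} (hβ : StrictMono β) (hsurj : Function.Surjective β) (c : ℝ) :
    StrictMono (distFn (Measure.map (fun x => β (x + c)) μ)) := by
  intro a b hab
  obtain ⟨a, rfl⟩ := hsurj a
  obtain ⟨b, rfl⟩ := hsurj b
  rw [distFn_map_comp_add_const hβ, distFn_map_comp_add_const hβ]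
  exact hμ (sub_lt_sub_right (hβ.lt_iff_lt.mp hab) c)

/-- Semiparametric transformation model: if `μ` has continuous strictly increasing CDF,
`β₀, β₁` are strictly increasing continuous bijections, and `μ_t` is the pushforward of `μ`
under `x ↦ β_t(x + c_t)`, then the quantile-quantile transform is
`Q_{μ₁}(F_{μ₀}(y)) = β₁(β₀⁻¹(y) + c₁ − c₀)`; in particular, if `c_t = k_t + m` then it equals
`β₁(β₀⁻¹(y) + k₁ − k₀)`, which does not depend on `m`. -/
theorem quantile_quantile_semiparametric_transformation
    (μ : Measure ℝ) [IsProbabilityMeasure μ]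
    (hFc : Continuous (distFn μ)) (hFs : StrictMono (distFn μ))
    (β₀ β₁ : ℝ → ℝ)
    (hβ₀s : StrictMono β₀) (hβ₀c : Continuous β₀) (hβ₀b : Function.Bijective β₀)
    (hβ₁s : StrictMono β₁) (hβ₁c : Continuous β₁) (hβ₁b : Function.Bijective β₁)
    (c₀ c₁ : ℝ)
    (μ₀ μ₁ : Measure ℝ)
    (hμ₀ : μ₀ = Measure.map (fun x => β₀ (x + c₀)) μ)
    (hμ₁ : μ₁ = Measure.map (fun x => β₁ (x + c₁)) μ) :
    (∀ y : ℝ, quantileFn μ₁ (distFn μ₀ y) = β₁ (Function.invFun β₀ y + c₁ - c₀))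
    ∧ (∀ k₀ k₁ m : ℝ, c₀ = k₀ + m → c₁ = k₁ + m →
        ∀ y : ℝ, quantileFn μ₁ (distFn μ₀ y) = β₁ (Function.invFun β₀ y + k₁ - k₀)) := by
  have main (y : ℝ) :
      quantileFn μ₁ (distFn μ₀ y) = β₁ (Function.invFun β₀ y + c₁ - c₀) := by
    have hF : distFn μ₀ y = distFn μ₁ (β₁ (Function.invFun β₀ y + c₁ - c₀)) := by
      conv_lhs => rw [← Function.rightInverse_invFun hβ₀b.surjective y]
      rw [hμ₀, hμ₁, distFn_map_comp_add_const hβ₀s, distFn_map_comp_add_const hβ₁s]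
      congr 1
      ring
    rw [hF, quantileFn_distFn_of_strictMono]
    rw [hμ₁]
    exact strictMono_distFn_map_comp_add_const hFs hβ₁s hβ₁b.surjective c₁
  refine ⟨main, fun k₀ k₁ m h₀ h₁ y => ?_⟩
  rw [main y, h₀, h₁]
  congr 1
  ring
end

section
/- Let (Ω, F, P) be a probability space, A ∈ {0,1} a random variable with P(A = 1) ∈ (0,1), and Y₀, Y₁ integrable real random variables. Suppose the conditional law of Y₁ given the event {A = 0} equals the pushforward of the conditional law of Y₀ given {A = 0} under the translation x ↦ x + c for some c ∈ ℝ, and that the conditional law of Y₀ given {A = 0} has continuous and strictly increasing CDF. Then: (i) c = E[Y₁ − Y₀ | A = 0]; (ii) Q_{Y₁|A=0}(F_{Y₀|A=0}(y)) = y + c for every y ∈ ℝ; (iii) E[Y₁ − Q_{Y₁|A=0}(F_{Y₀|A=0}(Y₀)) | A = 1] = E[Y₁ − Y₀ | A = 1] − E[Y₁ − Y₀ | A = 0], i.e., the identified functional reduces to the difference-in-differences formula. -/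
open MeasureTheory ProbabilityTheory Set

theorem distFn_map_add_right (μ : Measure ℝ) (c x : ℝ) :
    distFn (μ.map (fun x => x + c)) x = distFn μ (x - c) := by
  rw [distFn, Measure.map_apply (measurable_add_const c) measurableSet_Iic,
    Set.preimage_add_const_Iic, distFn]

/-- The quantile-quantile transform between a measure and its translate is the translation. -/
theorem quantileFn_map_add_right_distFn {μ : Measure ℝ} (hμ : StrictMono (distFn μ)) (c y : ℝ) :
    quantileFn (μ.map (fun x => x + c)) (distFn μ y) = y + c := by
  have h : {x : ℝ | distFn μ y ≤ distFn (μ.map (fun x => x + c)) x} = Set.Ici (y + c) := by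
    ext x
    simp [distFn_map_add_right, hμ.le_iff_le, le_sub_iff_add_le]
  rw [quantileFn, h, csInf_Ici]

theorem integral_sub_eq_of_map_eq_map_add_const {Ω : Type*} [MeasurableSpace Ω] {ν : Measure Ω}
    [IsProbabilityMeasure ν] {X Y : Ω → ℝ} (hX : Integrable X ν) (hY : Integrable Y ν) {c : ℝ}
    (h : ν.map Y = (ν.map X).map (fun x => x + c)) :
    ∫ ω, (Y ω - X ω) ∂ν = c := by
  have hmap : ν.map Y = ν.map (fun ω => X ω + c) := by
    rw [h, AEMeasurable.map_map_of_aemeasurable (measurable_add_const c).aemeasurable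
      hX.aemeasurable]
    rfl
  have hint : ∫ ω, Y ω ∂ν = ∫ ω, (X ω + c) ∂ν := by
    have hid : IdentDistrib Y (fun ω => X ω + c) ν ν :=
      ⟨hY.aemeasurable, hX.aemeasurable.add_const c, hmap⟩
    exact hid.integral_eq
  rw [integral_sub hY hX, hint, integral_add hX (integrable_const c)]
  simp

theorem integral_cond_eq_div {Ω : Type*} [MeasurableSpace Ω] (P : Measure Ω) (s : Set Ω)
    (f : Ω → ℝ) : ∫ ω, f ω ∂(P[|s]) = (∫ ω in s, f ω ∂P) / (P s).toReal := by
  rw [ProbabilityTheory.cond, integral_smul_measure, ENNReal.toReal_inv, smul_eq_mul, div_eq_inv_mul]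

/-- Linear model / difference-in-differences: if the conditional law of `Y₁` given `{A = 0}`
is the translation by `c` of the conditional law of `Y₀` given `{A = 0}`, and the latter has
continuous strictly increasing CDF, then (i) `c = E[Y₁ − Y₀ | A = 0]`, (ii) the
quantile-quantile transform is `y ↦ y + c`, and (iii) the identified functional
`E[Y₁ − Q_{Y₁|A=0}(F_{Y₀|A=0}(Y₀)) | A = 1]` reduces to the difference-in-differences formula
`E[Y₁ − Y₀ | A = 1] − E[Y₁ − Y₀ | A = 0]`. -/
theorem did_special_case
    {Ω : Type*} [MeasurableSpace Ω] (P : Measure Ω) [IsProbabilityMeasure P]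
    (A : Ω → ℝ) (hAmeas : Measurable A) (hA01 : ∀ ω, A ω = 0 ∨ A ω = 1)
    (hA1pos : 0 < P {ω | A ω = 1}) (hA1lt : P {ω | A ω = 1} < 1)
    (Y₀ Y₁ : Ω → ℝ) (hY₀m : Measurable Y₀) (hY₁m : Measurable Y₁)
    (hY₀i : Integrable Y₀ P) (hY₁i : Integrable Y₁ P)
    (μ₀ μ₁ : Measure ℝ)
    (hμ₀ : μ₀ = Measure.map Y₀ (P[|{ω | A ω = 0}]))
    (hμ₁ : μ₁ = Measure.map Y₁ (P[|{ω | A ω = 0}]))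
    (c : ℝ) (hshift : μ₁ = Measure.map (fun x => x + c) μ₀)
    (hFc : Continuous (distFn μ₀)) (hFs : StrictMono (distFn μ₀)) :
    c = (∫ ω in {ω | A ω = 0}, (Y₁ ω - Y₀ ω) ∂P) / (P {ω | A ω = 0}).toReal
    ∧ (∀ y : ℝ, quantileFn μ₁ (distFn μ₀ y) = y + c)
    ∧ (∫ ω in {ω | A ω = 1}, (Y₁ ω - quantileFn μ₁ (distFn μ₀ (Y₀ ω))) ∂P)
          / (P {ω | A ω = 1}).toReal
        = (∫ ω in {ω | A ω = 1}, (Y₁ ω - Y₀ ω) ∂P) / (P {ω | A ω = 1}).toReal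
          - (∫ ω in {ω | A ω = 0}, (Y₁ ω - Y₀ ω) ∂P) / (P {ω | A ω = 0}).toReal := by
  have hA0 : P {ω | A ω = 0} ≠ 0 := by
    intro h0
    have hcompl : {ω | A ω = 1}ᶜ = {ω | A ω = 0} := by
      ext ω
      rcases hA01 ω with h | h <;> simp [h]
    have hmeas : MeasurableSet {ω | A ω = 1} := hAmeas (measurableSet_singleton 1)
    rw [← hcompl, prob_compl_eq_zero_iff hmeas] at h0
    exact hA1lt.ne h0
  have hcond : IsProbabilityMeasure (P[|{ω | A ω = 0}]) := cond_isProbabilityMeasure hA0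
  have hint {Y : Ω → ℝ} (hY : Integrable Y P) : Integrable Y (P[|{ω | A ω = 0}]) :=
    hY.restrict.smul_measure (ENNReal.inv_ne_top.2 hA0)
  have hc : c = (∫ ω in {ω | A ω = 0}, (Y₁ ω - Y₀ ω) ∂P) / (P {ω | A ω = 0}).toReal := by
    rw [← integral_cond_eq_div, integral_sub_eq_of_map_eq_map_add_const (hint hY₀i) (hint hY₁i)]
    rw [← hμ₀, ← hμ₁, hshift]
  have hQ (y : ℝ) : quantileFn μ₁ (distFn μ₀ y) = y + c := by
    rw [hshift, quantileFn_map_add_right_distFn hFs]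
  refine ⟨hc, hQ, ?_⟩
  have hA1 : IsProbabilityMeasure (P[|{ω | A ω = 1}]) := cond_isProbabilityMeasure hA1pos.ne'
  have hdiff : Integrable (fun ω => Y₁ ω - Y₀ ω) (P[|{ω | A ω = 1}]) :=
    (hY₁i.sub hY₀i).restrict.smul_measure (ENNReal.inv_ne_top.2 hA1pos.ne')
  rw [← hc, ← integral_cond_eq_div, ← integral_cond_eq_div]
  simp_rw [hQ, ← sub_sub]
  rw [integral_sub hdiff (integrable_const c)]
  simp
end

section
/- Let (Ω, F, P) be a probability space carrying A ∈ {0,1} with π := P(A = 1) ∈ (0,1), a random element L in a standard Borel space E_L, and integrable real random variables Y₀, Y₁. Let γ : ℝ × E_L → ℝ be measurable with γ(Y₀, L) integrable, and suppose that almost surely on {A = 0} the conditional law of γ(Y₀, L) given (A, L) equals the conditional law of Y₁ given (A, L). Let ν : ℝ × E_L → ℝ be measurable with ν(·, l) locally integrable for each l, set R(x, l) := ∫₀ˣ ν(s, l) ds, and assume R(Y₁, L) and R(γ(Y₀, L), L) are integrable. Set θ := E[Y₁ − γ(Y₀, L) | A = 1]. Then E[ (A/π)(Y₁ − γ(Y₀,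 L) − θ) + ((1 − A)/π) ∫_{Y₁}^{γ(Y₀, L)} ν(x, L) dx ] = 0; that is, the efficient-influence-function-based estimating function for the ATT has mean zero at the true parameter and nuisance values. -/
open MeasureTheory ProbabilityTheory Set

/-- The primitive `x ↦ ∫ s in a..x, f s l` of a jointly measurable function is jointly measurable
in the endpoint `x` and the parameter `l`. -/
theorem measurable_intervalIntegral_right {E : Type*} [MeasurableSpace E] {f : ℝ → E → ℝ}
    (hf : Measurable fun p : ℝ × E => f p.1 p.2) (a : ℝ) :
    Measurable fun p : ℝ × E => ∫ s in a..p.1, f s p.2 := by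
  have hf' : Measurable fun q : (ℝ × E) × ℝ => f q.2 q.1.2 :=
    hf.comp (measurable_snd.prodMk (measurable_snd.comp measurable_fst))
  have h_indicator : ∀ lo hi : (ℝ × E) → ℝ, Measurable lo → Measurable hi →
      Measurable fun p : ℝ × E => ∫ s in Ioc (lo p) (hi p), f s p.2 := by
    intro lo hi hlo hhi
    have hS : MeasurableSet {q : (ℝ × E) × ℝ | q.2 ∈ Ioc (lo q.1) (hi q.1)} :=
      (measurableSet_lt (hlo.comp measurable_fst) measurable_snd).inter
        (measurableSet_le measurable_snd (hhi.comp measurable_fst))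
    have h := (hf'.indicator hS).stronglyMeasurable.integral_prod_right' (ν := volume)
    convert h.measurable using 2 with p
    rw [← integral_indicator measurableSet_Ioc]
    rfl
  exact (h_indicator _ _ measurable_const measurable_fst).sub
    (h_indicator _ _ measurable_fst measurable_const)

/-- If the conditional laws of `Y` and `Z` given `X` agree almost surely wherever the weight `w X`
does not vanish, then `w X * g X Y` and `w X * g X Z` have the same expectation. -/
theorem integral_mul_eq_of_condDistrib_eq {Ω β : Type*} [MeasurableSpace Ω] [MeasurableSpace β]
    {P : Measure Ω} [IsFiniteMeasure P] {X : Ω → β} {Y Z : Ω → ℝ}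
    (hX : Measurable X) (hY : Measurable Y) (hZ : Measurable Z)
    {w : β → ℝ} (hw : Measurable w) {g : β → ℝ → ℝ} (hg : Measurable fun p : β × ℝ => g p.1 p.2)
    (hlaw : ∀ᵐ ω ∂P, w (X ω) ≠ 0 → condDistrib Y X P (X ω) = condDistrib Z X P (X ω))
    (hgY : Integrable (fun ω => w (X ω) * g (X ω) (Y ω)) P)
    (hgZ : Integrable (fun ω => w (X ω) * g (X ω) (Z ω)) P) :
    ∫ ω, w (X ω) * g (X ω) (Y ω) ∂P = ∫ ω, w (X ω) * g (X ω) (Z ω) ∂P := by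
  have hm : StronglyMeasurable fun p : β × ℝ => w p.1 * g p.1 p.2 :=
    ((hw.comp measurable_fst).mul hg).stronglyMeasurable
  have key : ∀ V : Ω → ℝ, Measurable V → Integrable (fun ω => w (X ω) * g (X ω) (V ω)) P →
      ∫ ω, w (X ω) * g (X ω) (V ω) ∂P
        = ∫ ω, ∫ y, w (X ω) * g (X ω) y ∂(condDistrib V X P (X ω)) ∂P := by
    intro V hV hi
    rw [← integral_condExp hX.comap_le]
    exact integral_congr_ae (condExp_prod_ae_eq_integral_condDistrib hX hV.aemeasurable hm hi)
  rw [key Y hY hgY, key Z hZ hgZ]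
  refine integral_congr_ae ?_
  filter_upwards [hlaw] with ω h
  by_cases h0 : w (X ω) = 0
  · simp [h0]
  · rw [h h0]

/-- The efficient-influence-function-based estimating function for the ATT has mean zero at
the true parameter and nuisance values: if, conditionally on `(A, L)` and on `{A = 0}`, the
law of `γ(Y₀, L)` equals the law of `Y₁`, and `θ = E[Y₁ − γ(Y₀, L) | A = 1]`, then
`E[(A/π)(Y₁ − γ(Y₀, L) − θ) + ((1 − A)/π) ∫_{Y₁}^{γ(Y₀,L)} ν(x, L) dx] = 0`. -/
theorem att_eif_mean_zero
    {Ω E_L : Type*} [MeasurableSpace Ω]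
    [MeasurableSpace E_L] [StandardBorelSpace E_L] [Nonempty E_L]
    (P : Measure Ω) [IsProbabilityMeasure P]
    (A : Ω → ℝ) (hAmeas : Measurable A) (hA01 : ∀ ω, A ω = 0 ∨ A ω = 1)
    (hA1pos : 0 < P {ω | A ω = 1}) (hA1lt : P {ω | A ω = 1} < 1)
    (L : Ω → E_L) (hL : Measurable L)
    (Y₀ Y₁ : Ω → ℝ) (hY₀m : Measurable Y₀) (hY₁m : Measurable Y₁)
    (hY₀i : Integrable Y₀ P) (hY₁i : Integrable Y₁ P)
    (γ : ℝ → E_L → ℝ) (hγmeas : Measurable fun p : ℝ × E_L => γ p.1 p.2)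
    (hγint : Integrable (fun ω => γ (Y₀ ω) (L ω)) P)
    -- a.s. on {A = 0}, the conditional law of γ(Y₀, L) given (A, L) equals that of Y₁
    (hlaw : ∀ᵐ ω ∂P, A ω = 0 →
        condDistrib (fun ω => γ (Y₀ ω) (L ω)) (fun ω => (A ω, L ω)) P (A ω, L ω)
          = condDistrib Y₁ (fun ω => (A ω, L ω)) P (A ω, L ω))
    (ν : ℝ → E_L → ℝ) (hνmeas : Measurable fun p : ℝ × E_L => ν p.1 p.2)
    (hνloc : ∀ l : E_L, LocallyIntegrable (fun s => ν s l) volume)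
    (R : ℝ → E_L → ℝ) (hR : ∀ (x : ℝ) (l : E_L), R x l = ∫ s in (0:ℝ)..x, ν s l)
    (hRY₁ : Integrable (fun ω => R (Y₁ ω) (L ω)) P)
    (hRγ : Integrable (fun ω => R (γ (Y₀ ω) (L ω)) (L ω)) P)
    (θ : ℝ)
    (hθ : θ = (∫ ω in {ω | A ω = 1}, (Y₁ ω - γ (Y₀ ω) (L ω)) ∂P)
        / (P {ω | A ω = 1}).toReal) :
    ∫ ω, ((A ω / (P {ω | A ω = 1}).toReal) * (Y₁ ω - γ (Y₀ ω) (L ω) - θ)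
        + ((1 - A ω) / (P {ω | A ω = 1}).toReal)
          * ∫ x in (Y₁ ω)..(γ (Y₀ ω) (L ω)), ν x (L ω)) ∂P = 0 := by
  have hRm : Measurable fun p : ℝ × E_L => R p.1 p.2 := by
    simpa only [hR] using measurable_intervalIntegral_right hνmeas 0
  have hdiff : ∀ x y l, ∫ s in x..y, ν s l = R y l - R x l := by
    intro x y l
    have hii : ∀ a b, IntervalIntegrable (fun s => ν s l) volume a b := fun a b =>
      ((hνloc l).integrableOn_isCompact isCompact_uIcc).intervalIntegrable
    rw [hR, hR, intervalIntegral.integral_interval_sub_left (hii _ _) (hii _ _)]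
  have hA_bound : ∀ ω, ‖A ω‖ ≤ 1 := fun ω => by rcases hA01 ω with h | h <;> simp [h]
  have hA'_bound : ∀ ω, ‖1 - A ω‖ ≤ 1 := fun ω => by rcases hA01 ω with h | h <;> simp [h]
  have hA'meas : Measurable fun ω => 1 - A ω := measurable_const.sub hAmeas
  have hRY₁' := hRY₁.bdd_mul hA'meas.aestronglyMeasurable (.of_forall hA'_bound)
  have hRγ' := hRγ.bdd_mul hA'meas.aestronglyMeasurable (.of_forall hA'_bound)
  have hcontrol : ∫ ω, (1 - A ω) * R (γ (Y₀ ω) (L ω)) (L ω) ∂P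
      = ∫ ω, (1 - A ω) * R (Y₁ ω) (L ω) ∂P := by
    refine integral_mul_eq_of_condDistrib_eq (X := fun ω => (A ω, L ω))
      (w := fun p => 1 - p.1) (g := fun p y => R y p.2) (hAmeas.prodMk hL)
      (hγmeas.comp (hY₀m.prodMk hL)) hY₁m (measurable_const.sub measurable_fst)
      (hRm.comp (measurable_snd.prodMk (measurable_snd.comp measurable_fst))) ?_ hRγ' hRY₁'
    filter_upwards [hlaw] with ω h hne
    exact h ((hA01 ω).resolve_right fun h1 => hne (by simp [h1]))
  set D : Ω → ℝ := fun ω => Y₁ ω - γ (Y₀ ω) (L ω)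
  have hD : Integrable D P := hY₁i.sub hγint
  have hS : MeasurableSet {ω | A ω = 1} := hAmeas (measurableSet_singleton 1)
  have hA_mul : ∀ f : Ω → ℝ, ∫ ω, A ω * f ω ∂P = ∫ ω in {ω | A ω = 1}, f ω ∂P := by
    intro f
    rw [← integral_indicator hS]
    congr 1 with ω
    rcases hA01 ω with h | h <;> simp [indicator, h]
  have hπ : (P {ω | A ω = 1}).toReal ≠ 0 :=
    (ENNReal.toReal_pos hA1pos.ne' (measure_ne_top _ _)).ne'
  have htreated : ∫ ω, A ω * (D ω - θ) ∂P = 0 := by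
    rw [hA_mul, integral_sub hD.integrableOn (integrable_const θ).integrableOn,
      setIntegral_const, hθ, measureReal_def, smul_eq_mul, mul_div_cancel₀ _ hπ, sub_self]
  have hsplit : ∀ ω, A ω / (P {ω | A ω = 1}).toReal * (Y₁ ω - γ (Y₀ ω) (L ω) - θ)
        + (1 - A ω) / (P {ω | A ω = 1}).toReal
          * ∫ x in (Y₁ ω)..(γ (Y₀ ω) (L ω)), ν x (L ω)
      = (P {ω | A ω = 1}).toReal⁻¹ * (A ω * (D ω - θ)
        + ((1 - A ω) * R (γ (Y₀ ω) (L ω)) (L ω) - (1 - A ω) * R (Y₁ ω) (L ω))) := by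
    intro ω
    rw [hdiff]
    ring
  simp_rw [hsplit]
  rw [integral_const_mul, integral_add, htreated, integral_sub hRγ' hRY₁', hcontrol, sub_self,
    add_zero, mul_zero]
  · exact (hD.sub (integrable_const θ)).bdd_mul hAmeas.aestronglyMeasurable (.of_forall hA_bound)
  · exact hRγ'.sub hRY₁'
end

section
/- Let (Ω, F, P) carry A ∈ {0,1} with π := P(A = 1) ∈ (0,1), a random element L in a standard Borel space E_L, and bounded real random variables Y₀, Y₁. Let γ : ℝ × E_L → ℝ be bounded measurable such that almost surely on {A = 0} the conditional law of γ(Y₀, L) given (A, L) equals the conditional law of Y₁ given (A, L), and such that E[A | Y₀, L] = E[A | γ(Y₀, L), L] almost surely. Let ν : ℝ × E_L → ℝ be a bounded measurable function, continuously differentiable in its first argument with bounded derivative, satisfying ν(γ(Y₀, L), L) · E[1 − A | γ(Y₀, L), L] = E[A | γ(Y₀, L), L] almost surely (i.e., ν is the conditional odds of treatment given (γ(Y₀, L), L)). Set θ := E[Y₁ − γ(Y₀, L) | A = 1]. Let γ̃ be bounded measurable, ν̃ bounded measurable and continuously differentiable in its first argument with bounded derivative, and π̃ ∈ (0,1); put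 Δγ := γ̃ − γ, Δν := ν̃ − ν, Δπ := π̃ − π, and for λ ∈ [0,1) set γ_λ := γ + λΔγ, ν_λ := ν + λΔν, π_λ := π + λΔπ, and Φ(λ) := E[ π_λ⁻¹ ( A(Y₁ − γ_λ(Y₀, L) − θ) + (1 − A) ∫_{Y₁}^{γ_λ(Y₀, L)} ν_λ(x, L) dx ) ]. Then Φ is differentiable at λ = 0 and Φ′(0) = 0 (Neyman orthogonality of the estimating function with respect to the nuisance parameters). -/
open MeasureTheory ProbabilityTheory Set

section Primitive

variable {E : Type*} {f : ℝ → E → ℝ}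

lemma measurable_intervalIntegral_zero_param [MeasurableSpace E]
    (hf : Measurable fun p : ℝ × E => f p.1 p.2) :
    Measurable fun p : ℝ × E => ∫ x in (0 : ℝ)..p.1, f x p.2 := by
  have h : (fun p : ℝ × E => ∫ x in (0 : ℝ)..p.1, f x p.2)
      = fun p : ℝ × E => p.1 * ∫ t in Ioc (0 : ℝ) 1, f (p.1 * t) p.2 := by
    funext p
    rw [← intervalIntegral.integral_of_le zero_le_one,
      intervalIntegral.mul_integral_comp_mul_left (f := fun x => f x p.2)]
    simp
  rw [h]
  refine measurable_fst.mul (StronglyMeasurable.measurable ?_)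
  refine StronglyMeasurable.integral_prod_right'
    (f := fun q : (ℝ × E) × ℝ => f (q.1.1 * q.2) q.1.2) (Measurable.stronglyMeasurable ?_)
  exact hf.comp ((measurable_fst.fst.mul measurable_snd).prodMk measurable_fst.snd)

lemma intervalIntegral_eq_sub_zero (hf : ∀ l, Continuous fun x => f x l) (a b : ℝ) (l : E) :
    ∫ x in a..b, f x l = (∫ x in (0 : ℝ)..b, f x l) - ∫ x in (0 : ℝ)..a, f x l :=
  (intervalIntegral.integral_interval_sub_left ((hf l).intervalIntegrable _ _)
    ((hf l).intervalIntegrable _ _)).symm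

lemma Measurable.intervalIntegral_param {Ω : Type*} [MeasurableSpace Ω] [MeasurableSpace E]
    (hf : Measurable fun p : ℝ × E => f p.1 p.2)
    (hc : ∀ l, Continuous fun x => f x l) {a b : Ω → ℝ} {L : Ω → E} (ha : Measurable a)
    (hb : Measurable b) (hL : Measurable L) :
    Measurable fun ω => ∫ x in (a ω)..(b ω), f x (L ω) := by
  have h : (fun ω => ∫ x in (a ω)..(b ω), f x (L ω)) = fun ω =>
      (∫ x in (0 : ℝ)..(b ω), f x (L ω)) - ∫ x in (0 : ℝ)..(a ω), f x (L ω) :=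
    funext fun ω => intervalIntegral_eq_sub_zero hc _ _ _
  rw [h]
  exact ((measurable_intervalIntegral_zero_param hf).comp (hb.prodMk hL)).sub
    ((measurable_intervalIntegral_zero_param hf).comp (ha.prodMk hL))

lemma abs_intervalIntegral_le_of_bound {C : ℝ} (hC : ∀ x l, |f x l| ≤ C) {a b K : ℝ}
    (hK : |b - a| ≤ K) (l : E) : |∫ x in a..b, f x l| ≤ C * K := by
  have h := intervalIntegral.norm_integral_le_of_norm_le_const (a := a) (b := b)
    (f := fun x => f x l) (C := C) fun x _ => hC x l
  have hC0 : 0 ≤ C := (abs_nonneg _).trans (hC a l)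
  exact h.trans (mul_le_mul_of_nonneg_left hK hC0)

end Primitive

section Moment

variable {Ω E : Type*} [MeasurableSpace Ω] [MeasurableSpace E] {P : Measure Ω}
  [IsProbabilityMeasure P]

lemma integrable_of_measurable_of_abs_le {X : Ω → ℝ} (hX : Measurable X) {C : ℝ}
    (hC : ∀ ω, |X ω| ≤ C) : Integrable X P :=
  .of_bound hX.aestronglyMeasurable C (.of_forall hC)

lemma hasDerivAt_integral_weighted_primitive {f : ℝ → E → ℝ}
    (hf : Measurable fun p : ℝ × E => f p.1 p.2) (hfb : ∃ C : ℝ, ∀ x l, |f x l| ≤ C)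
    (hc : ∀ l, Continuous fun x => f x l) {W Y G D : Ω → ℝ} {L : Ω → E}
    (hW : Measurable W) (hY : Measurable Y) (hG : Measurable G) (hD : Measurable D)
    (hL : Measurable L) (hWb : ∃ C : ℝ, ∀ ω, |W ω| ≤ C) (hYb : ∃ C : ℝ, ∀ ω, |Y ω| ≤ C)
    (hGb : ∃ C : ℝ, ∀ ω, |G ω| ≤ C) (hDb : ∃ C : ℝ, ∀ ω, |D ω| ≤ C) :
    HasDerivAt (fun t : ℝ => ∫ ω, W ω * (∫ x in (Y ω)..(G ω + t * D ω), f x (L ω)) ∂P)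
      (∫ ω, W ω * (f (G ω) (L ω) * D ω) ∂P) 0 := by
  obtain ⟨cf, hcf⟩ := hfb
  obtain ⟨cW, hcW⟩ := hWb
  obtain ⟨cY, hcY⟩ := hYb
  obtain ⟨cG, hcG⟩ := hGb
  obtain ⟨cD, hcD⟩ := hDb
  have hmeas : ∀ t : ℝ, Measurable fun ω => W ω * ∫ x in (Y ω)..(G ω + t * D ω), f x (L ω) :=
    fun t => hW.mul (hf.intervalIntegral_param hc hY (hG.add (hD.const_mul t)) hL)
  have hmeas' : Measurable fun ω => W ω * (f (G ω + 0 * D ω) (L ω) * D ω) :=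
    hW.mul ((hf.comp ((hG.add (hD.const_mul 0)).prodMk hL)).mul hD)
  have key := hasDerivAt_integral_of_dominated_loc_of_deriv_le (μ := P) (𝕜 := ℝ)
    (F := fun t ω => W ω * ∫ x in (Y ω)..(G ω + t * D ω), f x (L ω)) (x₀ := 0)
    (F' := fun t ω => W ω * (f (G ω + t * D ω) (L ω) * D ω)) (bound := fun _ => cW * (cf * cD))
    (s := univ) Filter.univ_mem (.of_forall fun t => (hmeas t).aestronglyMeasurable)
    ?_ hmeas'.aestronglyMeasurable ?_ (integrable_const _) ?_
  · simpa using key.2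
  · refine integrable_of_measurable_of_abs_le (hmeas 0) (C := cW * (cf * (cG + cY))) fun ω => ?_
    rw [abs_mul]
    have h : |G ω + 0 * D ω - Y ω| ≤ cG + cY := by
      rw [zero_mul, add_zero]
      exact (abs_sub _ _).trans (add_le_add (hcG ω) (hcY ω))
    exact mul_le_mul (hcW ω) (abs_intervalIntegral_le_of_bound hcf h _) (abs_nonneg _)
      ((abs_nonneg _).trans (hcW ω))
  · refine .of_forall fun ω t _ => ?_
    rw [norm_mul, norm_mul]
    exact mul_le_mul (hcW ω)
      (mul_le_mul (hcf _ _) (hcD ω) (norm_nonneg _) ((abs_nonneg _).trans (hcf 0 (L ω))))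
      (by positivity) ((abs_nonneg _).trans (hcW ω))
  · refine .of_forall fun ω t _ => HasDerivAt.const_mul _ ?_
    have h1 := (hc (L ω)).integral_hasStrictDerivAt (Y ω) (G ω + t * D ω) |>.hasDerivAt
    have h2 : HasDerivAt (fun s : ℝ => G ω + s * D ω) (D ω) t := by
      simpa using ((hasDerivAt_id t).mul_const (D ω)).const_add (G ω)
    exact h1.comp t h2

/-- If the conditional laws of `U` and `V` given `X` agree wherever `h (X, ·)` does not vanish, then
`h (X, U)` and `h (X, V)` have the same expectation. -/
lemma integral_weight_eq_of_condDistrib_eq {β : Type*} [MeasurableSpace β] {X : Ω → β}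
    (hX : Measurable X) {U V : Ω → ℝ} (hU : Measurable U) (hV : Measurable V) {h : β × ℝ → ℝ}
    (hh : Measurable h) (hhU : Integrable (fun ω => h (X ω, U ω)) P)
    (hhV : Integrable (fun ω => h (X ω, V ω)) P)
    (hlaw : ∀ᵐ ω ∂P, (∀ y, h (X ω, y) = 0)
      ∨ condDistrib U X P (X ω) = condDistrib V X P (X ω)) :
    ∫ ω, h (X ω, U ω) ∂P = ∫ ω, h (X ω, V ω) ∂P := by
  have disint : ∀ Z : Ω → ℝ, Measurable Z → Integrable (fun ω => h (X ω, Z ω)) P →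
      ∫ ω, h (X ω, Z ω) ∂P = ∫ ω, ∫ y, h (X ω, y) ∂(condDistrib Z X P (X ω)) ∂P := by
    intro Z hZ hint
    have hXZ : Measurable fun ω => (X ω, Z ω) := hX.prodMk hZ
    have h1 : Integrable h (P.map X ⊗ₘ condDistrib Z X P) := by
      rw [compProd_map_condDistrib hZ.aemeasurable]
      exact (integrable_map_measure hh.aestronglyMeasurable hXZ.aemeasurable).2 hint
    have h2 := Measure.integral_compProd h1
    rw [compProd_map_condDistrib hZ.aemeasurable,
      integral_map hXZ.aemeasurable hh.aestronglyMeasurable] at h2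
    rw [h2, integral_map hX.aemeasurable]
    exact (StronglyMeasurable.integral_kernel_prod_right'
      hh.stronglyMeasurable).aestronglyMeasurable
  rw [disint U hU hhU, disint V hV hhV]
  refine integral_congr_ae ?_
  filter_upwards [hlaw] with ω hω
  rcases hω with h0 | h0
  · simp [h0]
  · rw [h0]

end Moment

lemma integral_mul_eq_integral_condExp_mul {Ω : Type*} {m m0 : MeasurableSpace Ω}
    {μ : Measure Ω} (hm : m ≤ m0) [SigmaFinite (μ.trim hm)] {X Z : Ω → ℝ}
    (hZ : StronglyMeasurable[m] Z) (hXZ : Integrable (fun ω => X ω * Z ω) μ)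
    (hX : Integrable X μ) :
    ∫ ω, X ω * Z ω ∂μ = ∫ ω, (μ[X | m]) ω * Z ω ∂μ := by
  rw [← integral_condExp hm]
  exact integral_congr_ae (condExp_mul_of_stronglyMeasurable_right hZ hXZ hX)

lemma condExp_one_sub {Ω : Type*} {m m0 : MeasurableSpace Ω} {μ : Measure Ω} [IsFiniteMeasure μ]
    (hm : m ≤ m0) {X : Ω → ℝ} (hX : Integrable X μ) :
    μ[fun ω => 1 - X ω | m] =ᵐ[μ] fun ω => 1 - (μ[X | m]) ω := by
  have h := condExp_sub (integrable_const (μ := μ) (1 : ℝ)) hX m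
  rw [condExp_const hm] at h
  exact h

/-- Neyman orthogonality of the efficient-influence-function-based estimating function for the
ATT: at the true nuisance values `(γ, ν, π)` and true parameter `θ`, the Gateaux derivative of
the moment function `Φ(λ) = E[ψ(W; θ, η + λ(η̃ − η))]` vanishes at `λ = 0`. -/
theorem att_eif_neyman_orthogonality
    {Ω E_L : Type*} [MeasurableSpace Ω]
    [MeasurableSpace E_L] [StandardBorelSpace E_L] [Nonempty E_L]
    (P : Measure Ω) [IsProbabilityMeasure P]
    (A : Ω → ℝ) (hAmeas : Measurable A) (hA01 : ∀ ω, A ω = 0 ∨ A ω = 1)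
    (π : ℝ) (hπ : π = (P {ω | A ω = 1}).toReal) (hπ0 : 0 < π) (hπ1 : π < 1)
    (L : Ω → E_L) (hL : Measurable L)
    (Y₀ Y₁ : Ω → ℝ) (hY₀m : Measurable Y₀) (hY₁m : Measurable Y₁)
    (hY₀b : ∃ C : ℝ, ∀ ω, |Y₀ ω| ≤ C) (hY₁b : ∃ C : ℝ, ∀ ω, |Y₁ ω| ≤ C)
    -- the true transformation γ
    (γ : ℝ → E_L → ℝ) (hγmeas : Measurable fun p : ℝ × E_L => γ p.1 p.2)
    (hγb : ∃ C : ℝ, ∀ (y : ℝ) (l : E_L), |γ y l| ≤ C)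
    -- a.s. on {A = 0}, the conditional law of γ(Y₀, L) given (A, L) equals that of Y₁
    (hlaw : ∀ᵐ ω ∂P, A ω = 0 →
        condDistrib (fun ω => γ (Y₀ ω) (L ω)) (fun ω => (A ω, L ω)) P (A ω, L ω)
          = condDistrib Y₁ (fun ω => (A ω, L ω)) P (A ω, L ω))
    -- E[A | Y₀, L] = E[A | γ(Y₀, L), L] a.s.
    (hproj : P[A | MeasurableSpace.comap (fun ω => (Y₀ ω, L ω)) inferInstance]
        =ᵐ[P] P[A | MeasurableSpace.comap (fun ω => (γ (Y₀ ω) (L ω), L ω)) inferInstance])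
    -- the true conditional odds ν
    (ν : ℝ → E_L → ℝ) (hνmeas : Measurable fun p : ℝ × E_L => ν p.1 p.2)
    (hνb : ∃ C : ℝ, ∀ (x : ℝ) (l : E_L), |ν x l| ≤ C)
    (hν₁ : ∀ l : E_L, ContDiff ℝ 1 fun x => ν x l)
    (hνdb : ∃ D : ℝ, ∀ (x : ℝ) (l : E_L), |deriv (fun s => ν s l) x| ≤ D)
    (hodds : ∀ᵐ ω ∂P,
        ν (γ (Y₀ ω) (L ω)) (L ω)
            * (P[(fun ω' => 1 - A ω') |
                MeasurableSpace.comap (fun ω => (γ (Y₀ ω) (L ω), L ω)) inferInstance]) ω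
          = (P[A | MeasurableSpace.comap (fun ω => (γ (Y₀ ω) (L ω), L ω)) inferInstance]) ω)
    -- the true parameter θ = E[Y₁ − γ(Y₀, L) | A = 1]
    (θ : ℝ)
    (hθ : θ = (∫ ω in {ω | A ω = 1}, (Y₁ ω - γ (Y₀ ω) (L ω)) ∂P)
        / (P {ω | A ω = 1}).toReal)
    -- perturbations of the nuisance parameters
    (γ' : ℝ → E_L → ℝ) (hγ'meas : Measurable fun p : ℝ × E_L => γ' p.1 p.2)
    (hγ'b : ∃ C : ℝ, ∀ (y : ℝ) (l : E_L), |γ' y l| ≤ C)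
    (ν' : ℝ → E_L → ℝ) (hν'meas : Measurable fun p : ℝ × E_L => ν' p.1 p.2)
    (hν'b : ∃ C : ℝ, ∀ (x : ℝ) (l : E_L), |ν' x l| ≤ C)
    (hν'₁ : ∀ l : E_L, ContDiff ℝ 1 fun x => ν' x l)
    (hν'db : ∃ D : ℝ, ∀ (x : ℝ) (l : E_L), |deriv (fun s => ν' s l) x| ≤ D)
    (π' : ℝ) (hπ'0 : 0 < π') (hπ'1 : π' < 1)
    -- the moment function along the path η_λ = η + λ(η̃ − η)
    (Φ : ℝ → ℝ)
    (hΦ : ∀ lam : ℝ, Φ lam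
      = ∫ ω, (π + lam * (π' - π))⁻¹
          * (A ω * (Y₁ ω
                - (γ (Y₀ ω) (L ω) + lam * (γ' (Y₀ ω) (L ω) - γ (Y₀ ω) (L ω))) - θ)
            + (1 - A ω)
              * ∫ x in (Y₁ ω)..(γ (Y₀ ω) (L ω)
                    + lam * (γ' (Y₀ ω) (L ω) - γ (Y₀ ω) (L ω))),
                  (ν x (L ω) + lam * (ν' x (L ω) - ν x (L ω)))) ∂P) :
    HasDerivAt Φ 0 0 := by
  have hBound : ∀ {f g : ℝ → E_L → ℝ}, (∃ C : ℝ, ∀ x l, |f x l| ≤ C) →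
      (∃ C : ℝ, ∀ x l, |g x l| ≤ C) → ∃ C : ℝ, ∀ x l, |f x l - g x l| ≤ C := by
    rintro f g ⟨c, hc⟩ ⟨d, hd⟩
    exact ⟨c + d, fun x l => (abs_sub _ _).trans (add_le_add (hc x l) (hd x l))⟩
  have hgb := hBound hν'b hνb
  have hDb' := hBound hγ'b hγb
  set g : ℝ → E_L → ℝ := fun x l => ν' x l - ν x l
  set G : Ω → ℝ := fun ω => γ (Y₀ ω) (L ω)
  set D : Ω → ℝ := fun ω => γ' (Y₀ ω) (L ω) - γ (Y₀ ω) (L ω)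
  set W : Ω → ℝ := fun ω => 1 - A ω with hWdef
  have hgmeas : Measurable fun p : ℝ × E_L => g p.1 p.2 := hν'meas.sub hνmeas
  have hνc : ∀ l, Continuous fun x => ν x l := fun l => (hν₁ l).continuous
  have hgc : ∀ l, Continuous fun x => g x l := fun l => (hν'₁ l).continuous.sub (hνc l)
  have hYL : Measurable fun ω => (Y₀ ω, L ω) := hY₀m.prodMk hL
  have hGm : Measurable G := hγmeas.comp hYL
  have hDm : Measurable D := (hγ'meas.comp hYL).sub hGm
  have hWm : Measurable W := measurable_const.sub hAmeas
  have hGb : ∃ C : ℝ, ∀ ω, |G ω| ≤ C := hγb.imp fun C h ω => h _ _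
  have hDb : ∃ C : ℝ, ∀ ω, |D ω| ≤ C := hDb'.imp fun C h ω => h _ _
  have hA1 : ∀ ω, |A ω| ≤ 1 := fun ω => by rcases hA01 ω with h | h <;> simp [h]
  have hW1 : ∀ ω, |W ω| ≤ 1 := fun ω => by
    rcases hA01 ω with h | h <;> simp [hWdef, h]
  have hAint : Integrable A P := integrable_of_measurable_of_abs_le hAmeas hA1
  have hWint : Integrable W P := integrable_of_measurable_of_abs_le hWm hW1
  have hGint : Integrable G P := hGb.elim fun _ h => integrable_of_measurable_of_abs_le hGm h
  have hDint : Integrable D P := hDb.elim fun _ h => integrable_of_measurable_of_abs_le hDm h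
  have hYint : Integrable Y₁ P := hY₁b.elim fun _ h => integrable_of_measurable_of_abs_le hY₁m h
  have hAmul : ∀ {Z : Ω → ℝ}, Integrable Z P → Integrable (fun ω => A ω * Z ω) P :=
    fun hZ => hZ.bdd_mul hAmeas.aestronglyMeasurable (.of_forall hA1)
  have hWmul : ∀ {Z : Ω → ℝ}, Integrable Z P → Integrable (fun ω => W ω * Z ω) P :=
    fun hZ => hZ.bdd_mul hWm.aestronglyMeasurable (.of_forall hW1)
  -- integrals of primitives
  have hprimInt : ∀ {f : ℝ → E_L → ℝ}, Measurable (fun p : ℝ × E_L => f p.1 p.2) →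
      (∃ C : ℝ, ∀ x l, |f x l| ≤ C) → (∀ l, Continuous fun x => f x l) →
      ∀ {a b : Ω → ℝ}, Measurable a → Measurable b → (∃ C : ℝ, ∀ ω, |a ω| ≤ C) →
      (∃ C : ℝ, ∀ ω, |b ω| ≤ C) → Integrable (fun ω => ∫ x in (a ω)..(b ω), f x (L ω)) P := by
    rintro f hf ⟨C, hC⟩ hc a b ha hb ⟨ca, hca⟩ ⟨cb, hcb⟩
    exact integrable_of_measurable_of_abs_le (hf.intervalIntegral_param hc ha hb hL)
      fun ω => abs_intervalIntegral_le_of_bound hC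
        ((abs_sub _ _).trans (add_le_add (hcb ω) (hca ω))) _
  have hzero : ∃ C : ℝ, ∀ _ : Ω, |(0 : ℝ)| ≤ C := ⟨0, fun _ => by simp⟩
  have hprim0 : ∀ {f : ℝ → E_L → ℝ}, Measurable (fun p : ℝ × E_L => f p.1 p.2) →
      (∃ C : ℝ, ∀ x l, |f x l| ≤ C) → (∀ l, Continuous fun x => f x l) →
      ∫ ω, W ω * (∫ x in (Y₁ ω)..(G ω), f x (L ω)) ∂P = 0 := by
    intro f hf hfb hc
    have hiG := hWmul (hprimInt hf hfb hc measurable_const hGm hzero hGb)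
    have hiY := hWmul (hprimInt hf hfb hc measurable_const hY₁m hzero hY₁b)
    have heq := integral_weight_eq_of_condDistrib_eq (P := P) (X := fun ω => (A ω, L ω))
      (U := G) (V := Y₁) (h := fun q => (1 - q.1.1) * ∫ x in (0 : ℝ)..q.2, f x q.1.2)
      (hAmeas.prodMk hL) hGm hY₁m
      ((measurable_const.sub measurable_fst.fst).mul
        ((measurable_intervalIntegral_zero_param hf).comp
          (measurable_snd.prodMk measurable_fst.snd)))
      hiG hiY
      (by
        filter_upwards [hlaw] with ω hω
        rcases hA01 ω with h | h
        · exact .inr (hω h)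
        · left
          intro y
          simp [h])
    have hsplit : (fun ω => W ω * (∫ x in (Y₁ ω)..(G ω), f x (L ω))) = fun ω =>
        W ω * (∫ x in (0 : ℝ)..(G ω), f x (L ω)) - W ω * (∫ x in (0 : ℝ)..(Y₁ ω), f x (L ω)) := by
      funext ω
      rw [intervalIntegral_eq_sub_zero hc, mul_sub]
    rw [hsplit, integral_sub hiG hiY, sub_eq_zero]
    exact heq
  -- the treated part of the moment function vanishes
  have hSm : MeasurableSet {ω | A ω = 1} := hAmeas (measurableSet_singleton 1)
  have hAset : ∀ Z : Ω → ℝ, ∫ ω, A ω * Z ω ∂P = ∫ ω in {ω | A ω = 1}, Z ω ∂P := by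
    intro Z
    rw [← integral_indicator hSm]
    refine integral_congr_ae (.of_forall fun ω => ?_)
    rcases hA01 ω with h | h <;> simp [h, indicator]
  have hA0 : ∫ ω, A ω * (Y₁ ω - G ω - θ) ∂P = 0 := by
    have hYG : Integrable (fun ω => Y₁ ω - G ω) P := hYint.sub hGint
    rw [hAset, integral_sub hYG.integrableOn (integrable_const _), setIntegral_const,
      Measure.real, ← hπ, hθ, ← hπ, smul_eq_mul, mul_div_cancel₀ _ hπ0.ne', sub_self]
  -- the first-order effects of perturbing the transformation cancel
  have hAD : ∫ ω, W ω * (ν (G ω) (L ω) * D ω) ∂P = ∫ ω, A ω * D ω ∂P := by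
    have hνG : Measurable fun ω => ν (G ω) (L ω) := hνmeas.comp (hGm.prodMk hL)
    have hνD : Integrable (fun ω => ν (G ω) (L ω) * D ω) P :=
      hνb.elim fun c hc => hDint.bdd_mul hνG.aestronglyMeasurable
        (.of_forall fun ω => hc (G ω) (L ω))
    have hm₁ := hYL.comap_le
    have hm₂ := (hGm.prodMk hL).comap_le
    have hYL' : Measurable[MeasurableSpace.comap (fun ω => (Y₀ ω, L ω)) inferInstance]
        fun ω => (Y₀ ω, L ω) := comap_measurable _
    have hG' : Measurable[MeasurableSpace.comap (fun ω => (Y₀ ω, L ω)) inferInstance] G :=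
      hγmeas.comp hYL'
    have hD' : Measurable[MeasurableSpace.comap (fun ω => (Y₀ ω, L ω)) inferInstance] D :=
      (hγ'meas.comp hYL').sub hG'
    have hνD' : Measurable[MeasurableSpace.comap (fun ω => (Y₀ ω, L ω)) inferInstance]
        fun ω => ν (G ω) (L ω) * D ω :=
      (hνmeas.comp (hG'.prodMk (measurable_snd.comp hYL'))).mul hD'
    rw [integral_mul_eq_integral_condExp_mul hm₁ hνD'.stronglyMeasurable (hWmul hνD) hWint,
      integral_mul_eq_integral_condExp_mul hm₁ hD'.stronglyMeasurable (hAmul hDint) hAint]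
    refine integral_congr_ae ?_
    filter_upwards [hproj, hodds, condExp_one_sub hm₁ hAint,
      condExp_one_sub hm₂ hAint] with ω h1 h2 h3 h4
    rw [h3, h1, ← h4, ← h2]
    ring
  -- decomposition of the moment function along the path
  have hΦ' : Φ = fun t : ℝ => (π + t * (π' - π))⁻¹ * (-(t * ∫ ω, A ω * D ω ∂P)
      + ((∫ ω, W ω * (∫ x in (Y₁ ω)..(G ω + t * D ω), ν x (L ω)) ∂P)
        + t * ∫ ω, W ω * (∫ x in (Y₁ ω)..(G ω + t * D ω), g x (L ω)) ∂P)) := by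
    funext t
    have hGDm : Measurable fun ω => G ω + t * D ω := hGm.add (hDm.const_mul t)
    have hGDb : ∃ C : ℝ, ∀ ω, |G ω + t * D ω| ≤ C := by
      obtain ⟨c, hc⟩ := hGb
      obtain ⟨d, hd⟩ := hDb
      refine ⟨c + |t| * d, fun ω => (abs_add_le _ _).trans (add_le_add (hc ω) ?_)⟩
      rw [abs_mul]
      exact mul_le_mul_of_nonneg_left (hd ω) (abs_nonneg t)
    have hi1 : Integrable (fun ω => A ω * (Y₁ ω - G ω - θ)) P :=
      hAmul ((hYint.sub hGint).sub (integrable_const θ))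
    have hi2 : Integrable (fun ω => t * (A ω * D ω)) P := (hAmul hDint).const_mul t
    have hi3 := hWmul (hprimInt hνmeas hνb hνc hY₁m hGDm hY₁b hGDb)
    have hi4 := (hWmul (hprimInt hgmeas hgb hgc hY₁m hGDm hY₁b hGDb)).const_mul t
    rw [hΦ t, integral_const_mul]
    congr 1
    rw [← integral_const_mul t, ← integral_const_mul t, ← zero_sub, ← hA0,
      ← integral_sub hi1 hi2, ← integral_add hi3 hi4]
    refine Eq.trans ?_ (integral_add (hi1.sub hi2) (hi3.add hi4))
    refine integral_congr_ae (.of_forall fun ω => ?_)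
    have hin : ∫ x in (Y₁ ω)..(G ω + t * D ω), (ν x (L ω) + t * g x (L ω))
        = (∫ x in (Y₁ ω)..(G ω + t * D ω), ν x (L ω))
          + t * ∫ x in (Y₁ ω)..(G ω + t * D ω), g x (L ω) := by
      rw [intervalIntegral.integral_add ((hνc _).intervalIntegrable _ _)
        (((hgc _).const_mul t).intervalIntegrable _ _), intervalIntegral.integral_const_mul]
    change A ω * (Y₁ ω - (G ω + t * D ω) - θ)
      + W ω * (∫ x in (Y₁ ω)..(G ω + t * D ω), (ν x (L ω) + t * g x (L ω))) = _
    rw [hin]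
    ring
  have hN₁ := hasDerivAt_integral_weighted_primitive (P := P) hνmeas hνb hνc hWm hY₁m hGm hDm hL
    ⟨1, hW1⟩ hY₁b hGb hDb
  have hN₂ := hasDerivAt_integral_weighted_primitive (P := P) hgmeas hgb hgc hWm hY₁m hGm hDm hL
    ⟨1, hW1⟩ hY₁b hGb hDb
  have hinv : HasDerivAt (fun t : ℝ => (π + t * (π' - π))⁻¹) (-(π' - π) / π ^ 2) 0 := by
    have h : HasDerivAt (fun t : ℝ => π + t * (π' - π)) (π' - π) 0 := by
      simpa using ((hasDerivAt_id (0 : ℝ)).mul_const (π' - π)).const_add π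
    simpa using h.fun_inv (by simpa using hπ0.ne')
  rw [hΦ']
  have hlin : HasDerivAt (fun t : ℝ => -(t * ∫ ω, A ω * D ω ∂P)) (-∫ ω, A ω * D ω ∂P) 0 := by
    simpa using ((hasDerivAt_id (0 : ℝ)).mul_const (∫ ω, A ω * D ω ∂P)).fun_neg
  refine (hinv.fun_mul (hlin.fun_add
    (hN₁.fun_add ((hasDerivAt_id (0 : ℝ)).fun_mul hN₂)))).congr_deriv ?_
  simp [hprim0 hνmeas hνb hνc, hprim0 hgmeas hgb hgc, hAD]
end

section
/- Let (Ω, F, P) carry A ∈ {0,1} with π := P(A = 1) ∈ (0,1), a random element L in a standard Borel space E_L, and bounded real random variables Y₀, Y₁. Let γ, γ̃ : ℝ × E_L → ℝ be bounded measurable, let ν, ν̃ : ℝ × E_L → ℝ be bounded measurable and continuously differentiable in their first argument with bounded, continuous derivatives, let π̃ ∈ (0,1), and let θ ∈ ℝ. Put Δγ := γ̃ − γ, Δν := ν̃ − ν, Δπ := π̃ − π, and for λ ∈ [0,1) set γ_λ := γ + λΔγ, ν_λ := ν + λΔν, π_λ := π + λΔπ, S_λ := A(Y₁ − γ_λ(Y₀,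 L) − θ) + (1 − A) ∫_{Y₁}^{γ_λ(Y₀, L)} ν_λ(x, L) dx, and Φ(λ) := E[π_λ⁻¹ S_λ]. Then Φ is twice differentiable on [0,1) with Φ″(λ) = π_λ⁻¹ E[S_λ″] − 2(Δπ/π_λ²) E[S_λ′] + 2(Δπ²/π_λ³) E[S_λ], where S_λ′ := −A·Δγ(Y₀, L) + (1 − A)[ Δγ(Y₀, L)·ν_λ(γ_λ(Y₀, L), L) + ∫_{Y₁}^{γ_λ(Y₀, L)} Δν(x, L) dx ] and S_λ″ := (1 − A)[ 2 Δγ(Y₀, L) Δν(γ_λ(Y₀, L), L) + Δγ(Y₀, L)² ∂_x ν_λ(γ_λ(Y₀, L), L) ]; in particular, Φ″ is continuous, and when π̃ = π one has Φ″(λ) = ((1 − π)/π) E[ 2 Δγ(Y₀, L) Δν(γ_λ(Y₀, L), L) + Δγ(Y₀, L)² ∂_x ν_λ(γ_λ(Y₀, L), L) | A = 0 ]. -/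
open MeasureTheory ProbabilityTheory Set

/-- A family of real functions on `Ω` bounded uniformly over the parameter window `[-2, 2]`. -/
def BoundedOnWindow {Ω : Type*} (f : ℝ → Ω → ℝ) : Prop :=
  ∃ C : ℝ, ∀ t ∈ Icc (-2 : ℝ) 2, ∀ ω, |f t ω| ≤ C

namespace BoundedOnWindow

variable {Ω : Type*} {f g : ℝ → Ω → ℝ}

theorem add (hf : BoundedOnWindow f) (hg : BoundedOnWindow g) :
    BoundedOnWindow fun t ω => f t ω + g t ω := by
  obtain ⟨C, hC⟩ := hf
  obtain ⟨D, hD⟩ := hg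
  exact ⟨C + D, fun t ht ω => (abs_add_le _ _).trans (add_le_add (hC t ht ω) (hD t ht ω))⟩

theorem neg (hf : BoundedOnWindow f) : BoundedOnWindow fun t ω => -f t ω := by
  obtain ⟨C, hC⟩ := hf
  exact ⟨C, fun t ht ω => by rw [abs_neg]; exact hC t ht ω⟩

theorem sub (hf : BoundedOnWindow f) (hg : BoundedOnWindow g) :
    BoundedOnWindow fun t ω => f t ω - g t ω := by
  simpa only [sub_eq_add_neg] using hf.add hg.neg

theorem mul (hf : BoundedOnWindow f) (hg : BoundedOnWindow g) :
    BoundedOnWindow fun t ω => f t ω * g t ω := by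
  obtain ⟨C, hC⟩ := hf
  obtain ⟨D, hD⟩ := hg
  refine ⟨C * D, fun t ht ω => ?_⟩
  rw [abs_mul]
  exact mul_le_mul (hC t ht ω) (hD t ht ω) (abs_nonneg _) ((abs_nonneg _).trans (hC t ht ω))

theorem const (c : ℝ) : BoundedOnWindow fun (_ : ℝ) (_ : Ω) => c :=
  ⟨|c|, fun _ _ _ => le_rfl⟩

theorem param : BoundedOnWindow fun (t : ℝ) (_ : Ω) => t :=
  ⟨2, fun _ ht _ => abs_le.2 ht⟩

theorem intervalIntegral (hf : BoundedOnWindow f) (hg : BoundedOnWindow g)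
    {h : ℝ → ℝ → Ω → ℝ} (hh : ∃ C : ℝ, ∀ t ∈ Icc (-2 : ℝ) 2, ∀ x ω, |h t x ω| ≤ C) :
    BoundedOnWindow fun t ω => ∫ x in (f t ω)..(g t ω), h t x ω := by
  obtain ⟨C, hC⟩ := hh
  obtain ⟨D, hD⟩ := hg.sub hf
  refine ⟨C * D, fun t ht ω => ?_⟩
  refine (intervalIntegral.norm_integral_le_of_norm_le_const
    (C := C) (f := fun x => h t x ω) (fun x _ => hC t ht x ω)).trans ?_
  exact mul_le_mul_of_nonneg_left (hD t ht ω) ((abs_nonneg _).trans (hC t ht 0 ω))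

theorem integrable [MeasurableSpace Ω] {P : Measure Ω} [IsFiniteMeasure P]
    (hf : BoundedOnWindow f) (hm : ∀ t, Measurable (f t)) {t : ℝ} (ht : t ∈ Icc (-2 : ℝ) 2) :
    Integrable (f t) P := by
  obtain ⟨C, hC⟩ := hf
  exact Integrable.of_bound (hm t).aestronglyMeasurable C (ae_of_all _ (hC t ht))

theorem hasDerivAt_integral [MeasurableSpace Ω] {P : Measure Ω} [IsFiniteMeasure P]
    (hf : BoundedOnWindow f) (hg : BoundedOnWindow g) (hm : ∀ t, Measurable (f t))
    (hm' : ∀ t, Measurable (g t)) (hd : ∀ t ω, HasDerivAt (fun s => f s ω) (g t ω) t)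
    {t : ℝ} (ht : t ∈ Ioo (-2 : ℝ) 2) :
    HasDerivAt (fun s => ∫ ω, f s ω ∂P) (∫ ω, g t ω ∂P) t := by
  obtain ⟨C, hC⟩ := hg
  exact (hasDerivAt_integral_of_dominated_loc_of_deriv_le (bound := fun _ => C)
    (Icc_mem_nhds ht.1 ht.2)
    (Filter.Eventually.of_forall fun s => (hm s).aestronglyMeasurable)
    (hf.integrable hm (Ioo_subset_Icc_self ht)) (hm' t).aestronglyMeasurable
    (ae_of_all _ fun ω s hs => hC s hs ω) (integrable_const C)
    (ae_of_all _ fun ω s _ => hd s ω)).2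

theorem continuousAt_integral [MeasurableSpace Ω] {P : Measure Ω} [IsFiniteMeasure P]
    (hf : BoundedOnWindow f) (hm : ∀ t, Measurable (f t))
    (hc : ∀ ω, Continuous fun s => f s ω) {t : ℝ} (ht : t ∈ Ioo (-2 : ℝ) 2) :
    ContinuousAt (fun s => ∫ ω, f s ω ∂P) t := by
  obtain ⟨C, hC⟩ := hf
  refine continuousAt_of_dominated (bound := fun _ => C)
    (Filter.Eventually.of_forall fun s => (hm s).aestronglyMeasurable) ?_
    (integrable_const C) (ae_of_all _ fun ω => (hc ω).continuousAt)
  filter_upwards [Icc_mem_nhds ht.1 ht.2] with s hs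
  exact ae_of_all _ (hC s hs)

end BoundedOnWindow

/-- The parameter derivative of a family of measurable functions is measurable. -/
theorem measurable_of_hasDerivAt_param {Ω : Type*} [MeasurableSpace Ω] {f g : ℝ → Ω → ℝ}
    (hm : ∀ t, Measurable (f t)) (hd : ∀ t ω, HasDerivAt (fun s => f s ω) (g t ω) t) (t : ℝ) :
    Measurable (g t) := by
  have hu : Filter.Tendsto (fun n : ℕ => t + 1 / ((n : ℝ) + 1)) Filter.atTop
      (nhdsWithin t {t}ᶜ) := by
    refine tendsto_nhdsWithin_iff.2 ⟨?_, Filter.Eventually.of_forall fun n => ?_⟩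
    · simpa using tendsto_one_div_add_atTop_nhds_zero_nat.const_add t
    · have : 0 < 1 / ((n : ℝ) + 1) := by positivity
      simpa using this.ne'
  refine measurable_of_tendsto_metrizable
    (f := fun (n : ℕ) ω => slope (fun s => f s ω) t (t + 1 / ((n : ℝ) + 1))) (fun n => ?_)
    (tendsto_pi_nhds.2 fun ω => (hasDerivAt_iff_tendsto_slope.1 (hd t ω)).comp hu)
  simp only [slope_def_field]
  exact ((hm _).sub (hm _)).div_const _

/-- Measurability of an interval integral with measurable endpoints and integrand. -/
theorem measurable_intervalIntegral_param {Ω : Type*} [MeasurableSpace Ω] {a b : Ω → ℝ}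
    (ha : Measurable a) (hb : Measurable b) {f : ℝ → Ω → ℝ}
    (hf : Measurable fun p : ℝ × Ω => f p.1 p.2) :
    Measurable fun ω => ∫ x in (a ω)..(b ω), f x ω := by
  have key : ∀ {a b : Ω → ℝ}, Measurable a → Measurable b →
      Measurable fun ω => ∫ x in Ioc (a ω) (b ω), f x ω := by
    intro a b ha hb
    have hs : MeasurableSet {p : Ω × ℝ | a p.1 < p.2 ∧ p.2 ≤ b p.1} :=
      (measurableSet_lt (ha.comp measurable_fst) measurable_snd).inter
        (measurableSet_le measurable_snd (hb.comp measurable_fst))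
    have h := (((hf.comp measurable_swap).indicator hs).stronglyMeasurable.integral_prod_right'
      (ν := (volume : Measure ℝ))).measurable
    convert h using 2 with ω
    rw [← integral_indicator measurableSet_Ioc]
    rfl
  exact (key ha hb).sub (key hb ha)

/-- Leibniz rule along an affine path of upper endpoints and integrands. -/
theorem hasDerivAt_intervalIntegral_affine {u v : ℝ → ℝ} (hu : Continuous u) (hv : Continuous v)
    (a c d t : ℝ) :
    HasDerivAt (fun s => ∫ x in a..(c + s * d), (u x + s * v x))
      (d * (u (c + t * d) + t * v (c + t * d)) + ∫ x in a..(c + t * d), v x) t := by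
  have hl : HasDerivAt (fun s : ℝ => c + s * d) d t := by
    simpa using ((hasDerivAt_id t).mul_const d).const_add c
  have hprim : ∀ {w : ℝ → ℝ}, Continuous w →
      HasDerivAt (fun s => ∫ x in a..(c + s * d), w x) (w (c + t * d) * d) t := fun {w} hw =>
    HasDerivAt.comp (h₂ := fun y => ∫ x in a..y, w x) t
      (hw.integral_hasStrictDerivAt a (c + t * d)).hasDerivAt hl
  have h := (hprim hu).add ((hasDerivAt_id t).mul (hprim hv))
  have hfun : (fun s => ∫ x in a..(c + s * d), (u x + s * v x))
      = (fun s => ∫ x in a..(c + s * d), u x) + id * fun s => ∫ x in a..(c + s * d), v x := by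
    funext s
    simp only [Pi.add_apply, Pi.mul_apply, id]
    rw [intervalIntegral.integral_add (hu.intervalIntegrable _ _)
      ((hv.const_mul s).intervalIntegrable _ _), intervalIntegral.integral_const_mul]
  rw [hfun]
  refine h.congr_deriv ?_
  simp only [id]
  ring

/-- Second-order bias structure of the ATT estimating function: along the path
`η_λ = η + λ(η̃ − η)` the moment function `Φ(λ) = E[π_λ⁻¹ S_λ]` is twice differentiable on
`[0,1)` with
`Φ″(λ) = π_λ⁻¹ E[S_λ″] − 2(Δπ/π_λ²) E[S_λ′] + 2(Δπ²/π_λ³) E[S_λ]`;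
in particular `Φ″` is continuous, and when `π̃ = π`,
`Φ″(λ) = ((1−π)/π) E[2 Δγ Δν(γ_λ) + Δγ² ∂ₓν_λ(γ_λ) | A = 0]`. -/
theorem att_eif_second_order_bias
    {Ω E_L : Type*} [MeasurableSpace Ω]
    [MeasurableSpace E_L] [StandardBorelSpace E_L] [Nonempty E_L]
    (P : Measure Ω) [IsProbabilityMeasure P]
    (A : Ω → ℝ) (hAmeas : Measurable A) (hA01 : ∀ ω, A ω = 0 ∨ A ω = 1)
    (π : ℝ) (hπ : π = (P {ω | A ω = 1}).toReal) (hπ0 : 0 < π) (hπ1 : π < 1)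
    (L : Ω → E_L) (hL : Measurable L)
    (Y₀ Y₁ : Ω → ℝ) (hY₀m : Measurable Y₀) (hY₁m : Measurable Y₁)
    (hY₀b : ∃ C : ℝ, ∀ ω, |Y₀ ω| ≤ C) (hY₁b : ∃ C : ℝ, ∀ ω, |Y₁ ω| ≤ C)
    (γ γ' : ℝ → E_L → ℝ)
    (hγmeas : Measurable fun p : ℝ × E_L => γ p.1 p.2)
    (hγ'meas : Measurable fun p : ℝ × E_L => γ' p.1 p.2)
    (hγb : ∃ C : ℝ, ∀ (y : ℝ) (l : E_L), |γ y l| ≤ C)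
    (hγ'b : ∃ C : ℝ, ∀ (y : ℝ) (l : E_L), |γ' y l| ≤ C)
    (ν ν' : ℝ → E_L → ℝ)
    (hνmeas : Measurable fun p : ℝ × E_L => ν p.1 p.2)
    (hν'meas : Measurable fun p : ℝ × E_L => ν' p.1 p.2)
    (hνb : ∃ C : ℝ, ∀ (x : ℝ) (l : E_L), |ν x l| ≤ C)
    (hν'b : ∃ C : ℝ, ∀ (x : ℝ) (l : E_L), |ν' x l| ≤ C)
    (hν₁ : ∀ l : E_L, ContDiff ℝ 1 fun x => ν x l)
    (hν'₁ : ∀ l : E_L, ContDiff ℝ 1 fun x => ν' x l)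
    (hνdb : ∃ D : ℝ, ∀ (x : ℝ) (l : E_L), |deriv (fun s => ν s l) x| ≤ D)
    (hν'db : ∃ D : ℝ, ∀ (x : ℝ) (l : E_L), |deriv (fun s => ν' s l) x| ≤ D)
    (π' : ℝ) (hπ'0 : 0 < π') (hπ'1 : π' < 1)
    (θ : ℝ)
    -- the perturbed nuisance components along the path
    (Γ : ℝ → Ω → ℝ)
    (hΓ : ∀ (lam : ℝ) (ω : Ω),
      Γ lam ω = γ (Y₀ ω) (L ω) + lam * (γ' (Y₀ ω) (L ω) - γ (Y₀ ω) (L ω)))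
    (N : ℝ → ℝ → E_L → ℝ)
    (hN : ∀ (lam x : ℝ) (l : E_L), N lam x l = ν x l + lam * (ν' x l - ν x l))
    -- S_λ, S_λ′, S_λ″ and Φ
    (S S₁ S₂ : ℝ → Ω → ℝ)
    (hS : ∀ (lam : ℝ) (ω : Ω), S lam ω
      = A ω * (Y₁ ω - Γ lam ω - θ)
        + (1 - A ω) * ∫ x in (Y₁ ω)..(Γ lam ω), N lam x (L ω))
    (hS₁ : ∀ (lam : ℝ) (ω : Ω), S₁ lam ω
      = -(A ω) * (γ' (Y₀ ω) (L ω) - γ (Y₀ ω) (L ω))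
        + (1 - A ω) * ((γ' (Y₀ ω) (L ω) - γ (Y₀ ω) (L ω)) * N lam (Γ lam ω) (L ω)
          + ∫ x in (Y₁ ω)..(Γ lam ω), (ν' x (L ω) - ν x (L ω))))
    (hS₂ : ∀ (lam : ℝ) (ω : Ω), S₂ lam ω
      = (1 - A ω) * (2 * (γ' (Y₀ ω) (L ω) - γ (Y₀ ω) (L ω))
            * (ν' (Γ lam ω) (L ω) - ν (Γ lam ω) (L ω))
          + (γ' (Y₀ ω) (L ω) - γ (Y₀ ω) (L ω)) ^ 2
            * deriv (fun s => N lam s (L ω)) (Γ lam ω)))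
    (Φ : ℝ → ℝ)
    (hΦ : ∀ lam : ℝ, Φ lam = ∫ ω, (π + lam * (π' - π))⁻¹ * S lam ω ∂P) :
    ∃ Φ₁ : ℝ → ℝ,
      (∀ lam ∈ Set.Ico (0:ℝ) 1, HasDerivWithinAt Φ (Φ₁ lam) (Set.Ico (0:ℝ) 1) lam)
      ∧ (∀ lam ∈ Set.Ico (0:ℝ) 1, HasDerivWithinAt Φ₁
          ((π + lam * (π' - π))⁻¹ * (∫ ω, S₂ lam ω ∂P)
            - 2 * ((π' - π) / (π + lam * (π' - π)) ^ 2) * (∫ ω, S₁ lam ω ∂P)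
            + 2 * ((π' - π) ^ 2 / (π + lam * (π' - π)) ^ 3) * (∫ ω, S lam ω ∂P))
          (Set.Ico (0:ℝ) 1) lam)
      ∧ ContinuousOn (fun lam =>
          (π + lam * (π' - π))⁻¹ * (∫ ω, S₂ lam ω ∂P)
            - 2 * ((π' - π) / (π + lam * (π' - π)) ^ 2) * (∫ ω, S₁ lam ω ∂P)
            + 2 * ((π' - π) ^ 2 / (π + lam * (π' - π)) ^ 3) * (∫ ω, S lam ω ∂P))
          (Set.Ico (0:ℝ) 1)
      ∧ (π' = π → ∀ lam ∈ Set.Ico (0:ℝ) 1,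
          (π + lam * (π' - π))⁻¹ * (∫ ω, S₂ lam ω ∂P)
            - 2 * ((π' - π) / (π + lam * (π' - π)) ^ 2) * (∫ ω, S₁ lam ω ∂P)
            + 2 * ((π' - π) ^ 2 / (π + lam * (π' - π)) ^ 3) * (∫ ω, S lam ω ∂P)
          = ((1 - π) / π)
            * ((∫ ω in {ω | A ω = 0},
                (2 * (γ' (Y₀ ω) (L ω) - γ (Y₀ ω) (L ω))
                    * (ν' (Γ lam ω) (L ω) - ν (Γ lam ω) (L ω))
                  + (γ' (Y₀ ω) (L ω) - γ (Y₀ ω) (L ω)) ^ 2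
                    * deriv (fun s => N lam s (L ω)) (Γ lam ω)) ∂P)
              / (P {ω | A ω = 0}).toReal)) := by
  -- pointwise regularity of the nuisance functions
  have hνc : ∀ l, Continuous fun x => ν x l := fun l => (hν₁ l).continuous
  have hν'c : ∀ l, Continuous fun x => ν' x l := fun l => (hν'₁ l).continuous
  have hνd : ∀ x l, HasDerivAt (fun s => ν s l) (deriv (fun s => ν s l) x) x := fun x l =>
    (((hν₁ l).differentiable one_ne_zero) x).hasDerivAt
  have hν'd : ∀ x l, HasDerivAt (fun s => ν' s l) (deriv (fun s => ν' s l) x) x := fun x l =>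
    (((hν'₁ l).differentiable one_ne_zero) x).hasDerivAt
  have hderivN : ∀ lam x l, deriv (fun s => N lam s l) x = deriv (fun s => ν s l) x
      + lam * (deriv (fun s => ν' s l) x - deriv (fun s => ν s l) x) := fun lam x l => by
    simp only [hN]
    exact ((hνd x l).add (((hν'd x l).sub (hνd x l)).const_mul lam)).deriv
  have hΓd : ∀ lam ω, HasDerivAt (fun s => Γ s ω) (γ' (Y₀ ω) (L ω) - γ (Y₀ ω) (L ω)) lam := by
    intro lam ω
    simp only [hΓ]
    simpa using ((hasDerivAt_id lam).mul_const (γ' (Y₀ ω) (L ω) - γ (Y₀ ω) (L ω))).const_add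
      (γ (Y₀ ω) (L ω))
  -- pointwise derivatives
  have hSd : ∀ lam ω, HasDerivAt (fun s => S s ω) (S₁ lam ω) lam := by
    intro lam ω
    have h := (((hΓd lam ω).const_sub (Y₁ ω)).sub_const θ).const_mul (A ω)
    have h' := (hasDerivAt_intervalIntegral_affine (hνc (L ω))
      (v := fun x => ν' x (L ω) - ν x (L ω)) ((hν'c (L ω)).sub (hνc (L ω)))
      (Y₁ ω) (γ (Y₀ ω) (L ω)) (γ' (Y₀ ω) (L ω) - γ (Y₀ ω) (L ω)) lam).const_mul (1 - A ω)
    simp only [hΓ] at h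
    simp only [hS, hS₁, hN, hΓ]
    refine (h.add h').congr_deriv ?_
    ring
  have hS₁d : ∀ lam ω, HasDerivAt (fun s => S₁ s ω) (S₂ lam ω) lam := by
    intro lam ω
    have hi : HasDerivAt (fun s => ∫ x in (Y₁ ω)..(Γ s ω), (ν' x (L ω) - ν x (L ω)))
        ((ν' (Γ lam ω) (L ω) - ν (Γ lam ω) (L ω)) * (γ' (Y₀ ω) (L ω) - γ (Y₀ ω) (L ω))) lam :=
      HasDerivAt.comp (h₂ := fun y => ∫ x in (Y₁ ω)..y, (ν' x (L ω) - ν x (L ω))) lam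
        (((hν'c (L ω)).sub (hνc (L ω))).integral_hasStrictDerivAt (Y₁ ω)
          (Γ lam ω)).hasDerivAt (hΓd lam ω)
    have hν1 := (hνd (Γ lam ω) (L ω)).comp lam (hΓd lam ω)
    have hν2 := (hν'd (Γ lam ω) (L ω)).comp lam (hΓd lam ω)
    have hNd := hν1.add ((hasDerivAt_id lam).mul (hν2.sub hν1))
    have h := (((hNd.const_mul (γ' (Y₀ ω) (L ω) - γ (Y₀ ω) (L ω))).add hi).const_mul
      (1 - A ω)).const_add (-(A ω) * (γ' (Y₀ ω) (L ω) - γ (Y₀ ω) (L ω)))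
    simp only [hS₁, hS₂, hderivN]
    simp only [hN]
    refine h.congr_deriv ?_
    simp only [id, Pi.sub_apply, Function.comp_apply]
    ring
  -- measurability
  have hYL : Measurable fun ω => (Y₀ ω, L ω) := hY₀m.prodMk hL
  have hΓm : ∀ lam, Measurable (Γ lam) := fun lam => by
    have h : Measurable fun ω => γ (Y₀ ω) (L ω) + lam * (γ' (Y₀ ω) (L ω) - γ (Y₀ ω) (L ω)) :=
      (hγmeas.comp hYL).add (((hγ'meas.comp hYL).sub (hγmeas.comp hYL)).const_mul lam)
    exact (funext (hΓ lam)) ▸ h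
  have hSm : ∀ lam, Measurable (S lam) := fun lam => by
    have hxL : Measurable fun p : ℝ × Ω => (p.1, L p.2) :=
      measurable_fst.prodMk (hL.comp measurable_snd)
    have hNm : Measurable fun p : ℝ × Ω => N lam p.1 (L p.2) := by
      simp only [hN]
      exact (hνmeas.comp hxL).add (((hν'meas.comp hxL).sub (hνmeas.comp hxL)).const_mul lam)
    rw [funext (hS lam)]
    exact (hAmeas.mul ((hY₁m.sub (hΓm lam)).sub_const θ)).add ((hAmeas.const_sub 1).mul
      (measurable_intervalIntegral_param hY₁m (hΓm lam) (f := fun x ω => N lam x (L ω)) hNm))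
  have hS₁m := measurable_of_hasDerivAt_param hSm hSd
  have hS₂m := measurable_of_hasDerivAt_param hS₁m hS₁d
  -- uniform bounds
  obtain ⟨Cγ, hCγ⟩ := hγb
  obtain ⟨Cγ', hCγ'⟩ := hγ'b
  obtain ⟨Cν, hCν⟩ := hνb
  obtain ⟨Cν', hCν'⟩ := hν'b
  obtain ⟨D, hD⟩ := hνdb
  obtain ⟨D', hD'⟩ := hν'db
  obtain ⟨CY, hCY⟩ := hY₁b
  have bA : BoundedOnWindow fun _ ω => A ω :=
    ⟨1, fun _ _ ω => by rcases hA01 ω with h | h <;> simp [h]⟩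
  have bA' : BoundedOnWindow fun _ ω => 1 - A ω := (BoundedOnWindow.const 1).sub bA
  have bY : BoundedOnWindow fun _ ω => Y₁ ω := ⟨CY, fun _ _ ω => hCY ω⟩
  have bγ : BoundedOnWindow fun _ ω => γ (Y₀ ω) (L ω) := ⟨Cγ, fun _ _ ω => hCγ _ _⟩
  have bγ' : BoundedOnWindow fun _ ω => γ' (Y₀ ω) (L ω) := ⟨Cγ', fun _ _ ω => hCγ' _ _⟩
  have bΔ := bγ'.sub bγ
  have bΓ : BoundedOnWindow Γ := by
    rw [funext fun lam => funext (hΓ lam)]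
    exact bγ.add (BoundedOnWindow.param.mul bΔ)
  have bν : ∀ x : ℝ → Ω → ℝ, BoundedOnWindow fun t ω => ν (x t ω) (L ω) :=
    fun x => ⟨Cν, fun _ _ ω => hCν _ _⟩
  have bν' : ∀ x : ℝ → Ω → ℝ, BoundedOnWindow fun t ω => ν' (x t ω) (L ω) :=
    fun x => ⟨Cν', fun _ _ ω => hCν' _ _⟩
  have bΔν : ∀ x l, |ν' x l - ν x l| ≤ Cν' + Cν := fun x l =>
    (abs_sub _ _).trans (add_le_add (hCν' x l) (hCν x l))
  have bN : ∀ t ∈ Icc (-2 : ℝ) 2, ∀ x l, |N t x l| ≤ Cν + 2 * (Cν' + Cν) := by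
    intro t ht x l
    rw [hN]
    refine (abs_add_le _ _).trans (add_le_add (hCν x l) ?_)
    rw [abs_mul]
    exact mul_le_mul (abs_le.2 ht) (bΔν x l) (abs_nonneg _) zero_le_two
  have bS : BoundedOnWindow S := by
    rw [funext fun lam => funext (hS lam)]
    exact (bA.mul ((bY.sub bΓ).sub (BoundedOnWindow.const θ))).add
      (bA'.mul (bY.intervalIntegral bΓ (h := fun t x ω => N t x (L ω))
        ⟨_, fun t ht x ω => bN t ht x (L ω)⟩))
  have bS₁ : BoundedOnWindow S₁ := by
    rw [funext fun lam => funext (hS₁ lam)]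
    exact (bA.neg.mul bΔ).add (bA'.mul ((bΔ.mul ⟨_, fun t ht ω => bN t ht _ (L ω)⟩).add
      (bY.intervalIntegral bΓ (h := fun _ x ω => ν' x (L ω) - ν x (L ω))
        ⟨_, fun t ht x ω => bΔν x (L ω)⟩)))
  have bdν : BoundedOnWindow fun t ω => deriv (fun s => ν s (L ω)) (Γ t ω) :=
    ⟨D, fun _ _ ω => hD _ _⟩
  have bdν' : BoundedOnWindow fun t ω => deriv (fun s => ν' s (L ω)) (Γ t ω) :=
    ⟨D', fun _ _ ω => hD' _ _⟩
  have bS₂ : BoundedOnWindow S₂ := by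
    rw [funext fun lam => funext (hS₂ lam)]
    simp only [hderivN, pow_two]
    exact bA'.mul ((((BoundedOnWindow.const 2).mul bΔ).mul ((bν' Γ).sub (bν Γ))).add
      ((bΔ.mul bΔ).mul (bdν.add (BoundedOnWindow.param.mul (bdν'.sub bdν)))))
  have cS₂ : ∀ ω, Continuous fun t => S₂ t ω := by
    intro ω
    have cΓ : Continuous fun t => Γ t ω :=
      continuous_iff_continuousAt.2 fun t => (hΓd t ω).continuousAt
    have c1 := (hνc (L ω)).comp cΓ
    have c2 := (hν'c (L ω)).comp cΓ
    have c3 := ((hν₁ (L ω)).continuous_deriv_one).comp cΓ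
    have c4 := ((hν'₁ (L ω)).continuous_deriv_one).comp cΓ
    simp only [hS₂, hderivN]
    exact (((c2.sub c1).const_mul _).add
      ((c3.add (continuous_id.mul (c4.sub c3))).const_mul _)).const_mul _
  -- differentiation under the expectation
  have hwin : ∀ lam ∈ Ico (0 : ℝ) 1, lam ∈ Ioo (-2 : ℝ) 2 := fun lam h =>
    ⟨by linarith [h.1], by linarith [h.2]⟩
  have hE : ∀ lam ∈ Ico (0 : ℝ) 1,
      HasDerivAt (fun s => ∫ ω, S s ω ∂P) (∫ ω, S₁ lam ω ∂P) lam := fun lam h =>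
    bS.hasDerivAt_integral bS₁ hSm hS₁m hSd (hwin lam h)
  have hE₁ : ∀ lam ∈ Ico (0 : ℝ) 1,
      HasDerivAt (fun s => ∫ ω, S₁ s ω ∂P) (∫ ω, S₂ lam ω ∂P) lam := fun lam h =>
    bS₁.hasDerivAt_integral bS₂ hS₁m hS₂m hS₁d (hwin lam h)
  have hpos : ∀ lam ∈ Ico (0 : ℝ) 1, π + lam * (π' - π) ≠ 0 := fun lam h => by
    have h1 := mul_pos (sub_pos.2 h.2) hπ0
    have h2 := mul_nonneg h.1 hπ'0.le
    have : π + lam * (π' - π) = (1 - lam) * π + lam * π' := by ring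
    rw [this]
    positivity
  have hp : ∀ lam, HasDerivAt (fun s : ℝ => π + s * (π' - π)) (π' - π) lam := fun lam => by
    simpa using ((hasDerivAt_id lam).mul_const (π' - π)).const_add π
  refine ⟨fun lam => (π + lam * (π' - π))⁻¹ * (∫ ω, S₁ lam ω ∂P)
    - (π' - π) * ((π + lam * (π' - π))⁻¹ * (π + lam * (π' - π))⁻¹) * (∫ ω, S lam ω ∂P),
    fun lam h => ?_, fun lam h => ?_, fun lam h => ?_, ?_⟩
  · have hq := hpos lam h
    have hd := ((hp lam).inv hq).mul (hE lam h)
    rw [funext hΦ]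
    simp only [integral_const_mul]
    refine HasDerivAt.hasDerivWithinAt ?_
    refine hd.congr_deriv ?_
    simp only [Pi.inv_apply]
    field_simp
    ring
  · have hq := hpos lam h
    have hi := (hp lam).inv hq
    have hd := (hi.mul (hE₁ lam h)).sub (((hi.mul hi).const_mul (π' - π)).mul (hE lam h))
    refine HasDerivAt.hasDerivWithinAt ?_
    refine hd.congr_deriv ?_
    simp only [Pi.inv_apply, Pi.mul_apply]
    field_simp
    ring
  · have hq := hpos lam h
    have cp := (hp lam).continuousAt
    have c2 := bS₂.continuousAt_integral (P := P) hS₂m cS₂ (hwin lam h)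
    refine ContinuousAt.continuousWithinAt ?_
    exact (((cp.inv₀ hq).mul c2).sub ((continuousAt_const.mul
      (continuousAt_const.div (cp.pow 2) (pow_ne_zero 2 hq))).mul (hE₁ lam h).continuousAt)).add
      ((continuousAt_const.mul (continuousAt_const.div (cp.pow 3) (pow_ne_zero 3 hq))).mul
        (hE lam h).continuousAt)
  · rintro rfl lam -
    have hm0 : MeasurableSet {ω | A ω = 0} := hAmeas (measurableSet_singleton 0)
    have hm1 : MeasurableSet {ω | A ω = 1} := hAmeas (measurableSet_singleton 1)
    have hP0 : (P {ω | A ω = 0}).toReal = 1 - π' := by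
      have hcompl : {ω | A ω = 0} = {ω | A ω = 1}ᶜ := by
        ext ω
        rcases hA01 ω with h | h <;> simp [h]
      rw [hcompl, hπ]
      exact probReal_compl_eq_one_sub hm1
    have hint : ∫ ω, S₂ lam ω ∂P = ∫ ω in {ω | A ω = 0},
        (2 * (γ' (Y₀ ω) (L ω) - γ (Y₀ ω) (L ω))
            * (ν' (Γ lam ω) (L ω) - ν (Γ lam ω) (L ω))
          + (γ' (Y₀ ω) (L ω) - γ (Y₀ ω) (L ω)) ^ 2
            * deriv (fun s => N lam s (L ω)) (Γ lam ω)) ∂P := by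
      rw [← integral_indicator hm0]
      refine integral_congr_ae (ae_of_all _ fun ω => ?_)
      rcases hA01 ω with h | h <;> simp [hS₂, indicator, h]
    have h1 : (1 - π') ≠ 0 := (sub_pos.2 hπ1).ne'
    rw [hP0, hint]
    simp only [sub_self, mul_zero, add_zero, zero_div, zero_mul, sub_zero, ne_eq,
      OfNat.ofNat_ne_zero, not_false_eq_true, zero_pow]
    field_simp
end

section
/- Let (Ω, F, P) carry A ∈ {0,1} with π := P(A = 1) ∈ (0,1), a random element L in a standard Borel space E_L, and real random variables Y₀, Y₁. Let γ : ℝ × E_L → ℝ be measurable and suppose that almost surely on {A = 0} the conditional law of γ(Y₀, L) given (A, L) equals the conditional law of Y₁ given (A, L). Fix y ∈ ℝ with P(Y₁ = y | A = 0) = 0 and P(γ(Y₀, L) = y | A = 0) = 0, and let ν̄ : E_L → ℝ be bounded measurable. Define ϑ := P(γ(Y₀, L) < y | A = 1) and χ := sign(Y₁ − γ(Y₀, L)) · 1{ min(Y₁, γ(Y₀, L)) ≤ y ≤ max(Y₁, γ(Y₀, L)) }, where sign(x) := 1{x > 0} − 1{x < 0}. Then E[ (A/π)( 1{γ(Y₀,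 L) < y} − ϑ ) + ((A − 1)/π) ν̄(L) χ ] = 0; that is, the efficient influence function for the counterfactual distribution on the treated has mean zero at the true values. -/
open MeasureTheory ProbabilityTheory Set

/-- If the conditional laws of `Z` and `W` given `X` agree wherever `f (X ω, ·)` is nonzero,
then `f (X, Z)` and `f (X, W)` have the same mean. -/
theorem integral_comp_prodMk_congr_of_condDistrib {Ω β F : Type*}
    [MeasurableSpace Ω] [MeasurableSpace β] [MeasurableSpace F] [StandardBorelSpace F]
    [Nonempty F] {P : Measure Ω} [IsFiniteMeasure P] {X : Ω → β} {Z W : Ω → F}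
    (hX : Measurable X) (hZ : Measurable Z) (hW : Measurable W)
    {f : β × F → ℝ} (hf : Measurable f) {C : ℝ} (hC : ∀ p, |f p| ≤ C)
    (h : ∀ᵐ ω ∂P, (∀ z, f (X ω, z) = 0) ∨
      condDistrib Z X P (X ω) = condDistrib W X P (X ω)) :
    ∫ ω, f (X ω, Z ω) ∂P = ∫ ω, f (X ω, W ω) ∂P := by
  have key : ∀ V : Ω → F, Measurable V →
      ∫ ω, f (X ω, V ω) ∂P = ∫ ω, ∫ z, f (X ω, z) ∂(condDistrib V X P (X ω)) ∂P := by
    intro V hV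
    have hint : Integrable (fun ω => f (X ω, V ω)) P :=
      .of_bound (hf.comp (hX.prodMk hV)).aestronglyMeasurable C (.of_forall fun ω => hC _)
    rw [← integral_congr_ae (condExp_prod_ae_eq_integral_condDistrib hX hV.aemeasurable
      hf.stronglyMeasurable hint), integral_condExp hX.comap_le]
  rw [key Z hZ, key W hW]
  refine integral_congr_ae ?_
  filter_upwards [h] with ω hω
  rcases hω with h0 | h1
  · simp [h0]
  · simp only [h1]

/-- The compound sign of `b - a` across a level `y` hit by neither number is the difference of
the indicators of lying below `y`. -/
theorem compound_sign_eq_sub_indicator {a b y : ℝ} (ha : a ≠ y) (hb : b ≠ y) :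
    ((if a < b then (1:ℝ) else 0) - (if b < a then (1:ℝ) else 0))
        * (if min b a ≤ y ∧ y ≤ max b a then (1:ℝ) else 0)
      = (if a < y then (1:ℝ) else 0) - (if b < y then (1:ℝ) else 0) := by
  simp only [min_le_iff, le_max_iff]
  split_ifs <;> grind

/-- The efficient influence function for the counterfactual distribution on the treated (CDT)
has mean zero at the true values: with `ϑ = P(γ(Y₀, L) < y | A = 1)` and the compound sign
function `χ = sign(Y₁ − γ(Y₀,L)) · 1{min(Y₁, γ(Y₀,L)) ≤ y ≤ max(Y₁, γ(Y₀,L))}`,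
`E[(A/π)(1{γ(Y₀,L) < y} − ϑ) + ((A − 1)/π) nuBar(L) χ] = 0`. -/
theorem cdt_eif_mean_zero
    {Ω E_L : Type*} [MeasurableSpace Ω]
    [MeasurableSpace E_L] [StandardBorelSpace E_L] [Nonempty E_L]
    (P : Measure Ω) [IsProbabilityMeasure P]
    (A : Ω → ℝ) (hAmeas : Measurable A) (hA01 : ∀ ω, A ω = 0 ∨ A ω = 1)
    (hA1pos : 0 < P {ω | A ω = 1}) (hA1lt : P {ω | A ω = 1} < 1)
    (L : Ω → E_L) (hL : Measurable L)
    (Y₀ Y₁ : Ω → ℝ) (hY₀m : Measurable Y₀) (hY₁m : Measurable Y₁)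
    (γ : ℝ → E_L → ℝ) (hγmeas : Measurable fun p : ℝ × E_L => γ p.1 p.2)
    -- a.s. on {A = 0}, the conditional law of γ(Y₀, L) given (A, L) equals that of Y₁
    (hlaw : ∀ᵐ ω ∂P, A ω = 0 →
        condDistrib (fun ω => γ (Y₀ ω) (L ω)) (fun ω => (A ω, L ω)) P (A ω, L ω)
          = condDistrib Y₁ (fun ω => (A ω, L ω)) P (A ω, L ω))
    -- the point y carries no conditional mass given {A = 0}
    (y : ℝ)
    (hy₁ : (P[|{ω | A ω = 0}]) {ω | Y₁ ω = y} = 0)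
    (hyγ : (P[|{ω | A ω = 0}]) {ω | γ (Y₀ ω) (L ω) = y} = 0)
    (nuBar : E_L → ℝ) (hnuBarmeas : Measurable nuBar) (hnuBarb : ∃ C : ℝ, ∀ l : E_L, |nuBar l| ≤ C)
    -- ϑ = P(γ(Y₀, L) < y | A = 1)
    (ϑ : ℝ)
    (hϑ : ϑ = (P ({ω | γ (Y₀ ω) (L ω) < y} ∩ {ω | A ω = 1})).toReal
        / (P {ω | A ω = 1}).toReal)
    -- the compound sign function χ
    (χ : Ω → ℝ)
    (hχ : ∀ ω, χ ω
      = ((if γ (Y₀ ω) (L ω) < Y₁ ω then (1:ℝ) else 0)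
          - (if Y₁ ω < γ (Y₀ ω) (L ω) then (1:ℝ) else 0))
        * (if min (Y₁ ω) (γ (Y₀ ω) (L ω)) ≤ y ∧ y ≤ max (Y₁ ω) (γ (Y₀ ω) (L ω))
            then (1:ℝ) else 0)) :
    ∫ ω, ((A ω / (P {ω | A ω = 1}).toReal)
          * ((if γ (Y₀ ω) (L ω) < y then (1:ℝ) else 0) - ϑ)
        + ((A ω - 1) / (P {ω | A ω = 1}).toReal) * nuBar (L ω) * χ ω) ∂P = 0 := by
  have hmeas (a : ℝ) : MeasurableSet {ω | A ω = a} := hAmeas (measurableSet_singleton a)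
  have hG : Measurable fun ω => γ (Y₀ ω) (L ω) := hγmeas.comp (hY₀m.prodMk hL)
  obtain ⟨C, hC⟩ := hnuBarb
  set π := (P {ω | A ω = 1}).toReal with hπ
  have hπ0 : π ≠ 0 := (ENNReal.toReal_pos hA1pos.ne' (measure_ne_top _ _)).ne'
  have ae_ne (V : Ω → ℝ) (hV : (P[|{ω | A ω = 0}]) {ω | V ω = y} = 0) :
      ∀ᵐ ω ∂P, A ω = 0 → V ω ≠ y := by
    rw [cond_apply (hmeas 0)] at hV
    have h0 : P ({ω | A ω = 0} ∩ {ω | V ω = y}) = 0 :=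
      (mul_eq_zero.1 hV).resolve_left (ENNReal.inv_ne_zero.2 (measure_ne_top _ _))
    rw [ae_iff]
    refine measure_mono_null (fun ω hω => ?_) h0
    simpa using hω
  let f : (ℝ × E_L) × ℝ → ℝ := fun p =>
    if p.1.1 = 0 then nuBar p.1.2 * (if p.2 < y then 1 else 0) else 0
  have hf : Measurable f := by
    refine Measurable.ite ?_ ?_ measurable_const
    · exact (measurable_fst.comp measurable_fst) (measurableSet_singleton 0)
    · exact (hnuBarmeas.comp (measurable_snd.comp measurable_fst)).mul
        (Measurable.ite (measurableSet_lt measurable_snd measurable_const)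
          measurable_const measurable_const)
  have hfC : ∀ p, |f p| ≤ C := by
    intro p
    have h1 := hC p.1.2
    have h2 := (abs_nonneg _).trans h1
    simp only [f]
    split_ifs <;> simpa
  have hX : Measurable fun ω => (A ω, L ω) := hAmeas.prodMk hL
  have hfint (V : Ω → ℝ) (hV : Measurable V) :
      Integrable (fun ω => f ((A ω, L ω), V ω)) P :=
    .of_bound (hf.comp (hX.prodMk hV)).aestronglyMeasurable C (.of_forall fun ω => hfC _)
  have hswap : ∫ ω, f ((A ω, L ω), γ (Y₀ ω) (L ω)) ∂P = ∫ ω, f ((A ω, L ω), Y₁ ω) ∂P := by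
    refine integral_comp_prodMk_congr_of_condDistrib hX hG hY₁m hf hfC ?_
    filter_upwards [hlaw] with ω hω
    by_cases h0 : A ω = 0
    · exact .inr (hω h0)
    · exact .inl fun z => if_neg h0
  let S : Set Ω := {ω | γ (Y₀ ω) (L ω) < y} ∩ {ω | A ω = 1}
  have hS : MeasurableSet S := (measurableSet_lt hG measurable_const).inter (hmeas 1)
  have hSint : Integrable (S.indicator fun _ => (1:ℝ)) P :=
    (integrable_const _).indicator hS
  have hTint : Integrable ({ω | A ω = 1}.indicator fun _ => ϑ) P :=
    (integrable_const _).indicator (hmeas 1)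
  have hae : (fun ω => (A ω / π) * ((if γ (Y₀ ω) (L ω) < y then (1:ℝ) else 0) - ϑ)
        + ((A ω - 1) / π) * nuBar (L ω) * χ ω) =ᵐ[P]
      fun ω => π⁻¹ * ((S.indicator (fun _ => (1:ℝ)) ω - {ω | A ω = 1}.indicator (fun _ => ϑ) ω)
        - (f ((A ω, L ω), γ (Y₀ ω) (L ω)) - f ((A ω, L ω), Y₁ ω))) := by
    filter_upwards [ae_ne _ hy₁, ae_ne _ hyγ] with ω h1 hg
    rcases hA01 ω with h | h
    · rw [hχ, compound_sign_eq_sub_indicator (hg h) (h1 h)]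
      simp only [S, f, h, indicator, mem_inter_iff, mem_ofPred_eq]
      simp [-mul_ite]
      ring
    · simp only [S, f, h, indicator, mem_inter_iff, mem_ofPred_eq]
      simp [div_eq_inv_mul]
  rw [integral_congr_ae hae, integral_const_mul,
    integral_sub (by exact hSint.sub hTint) (by exact (hfint _ hG).sub (hfint _ hY₁m)),
    integral_sub hSint hTint, integral_sub (hfint _ hG) (hfint _ hY₁m), hswap,
    integral_indicator_const _ hS, integral_indicator_const _ (hmeas 1), hϑ]
  simp only [Measure.real, smul_eq_mul, ← hπ, S]
  field_simp
  ring
end
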